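/- arXiv:2509.04189 — 3 statements merged into one kernel-verified Lean document; each statement's English description precedes it below -/
import Mathlib

section
/- Let μ be a Radon measure on ℝⁿ and let Λ : ℝⁿ → GL(n,ℝ) be a Borel map assigning to each point an invertible n×n real matrix. Then for μ-almost every p ∈ ℝⁿ, every ν ∈ Tan_Λ(μ,p) has the following two properties: (1) T_{x,r}[ν] ∈ Tan_Λ(μ,p) for every x ∈ spt ν and every r > 0; (2) Tan(ν,x) ⊆ Tan_Λ(μ,p) for every x ∈ spt ν. -/
open MeasureTheory Metric Filter Topology Set

/-- The pushforward of `μ` under `T_{a,r}(x) = (x - a)/r`. -/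
noncomputable def blowup {n : ℕ} (μ : Measure (EuclideanSpace ℝ (Fin n)))
    (a : EuclideanSpace ℝ (Fin n)) (r : ℝ) : Measure (EuclideanSpace ℝ (Fin n)) :=
  Measure.map (fun x => r⁻¹ • (x - a)) μ

/-- Weak-* convergence of a sequence of measures on `ℝⁿ`. -/
def WeakStarTendsto {n : ℕ} (μ : ℕ → Measure (EuclideanSpace ℝ (Fin n)))
    (ν : Measure (EuclideanSpace ℝ (Fin n))) : Prop :=
  ∀ f : EuclideanSpace ℝ (Fin n) → ℝ, Continuous f → HasCompactSupport f →
    Tendsto (fun i => ∫ x, f x ∂(μ i)) atTop (𝓝 (∫ x, f x ∂ν))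

/-- The tangent measures of `μ` at `a`: nonzero Radon measures `ν` which are weak-* limits
of `c_i T_{a,r_i}[μ]` for some `c_i > 0` and `r_i ↓ 0`. -/
def TanM {n : ℕ} (μ : Measure (EuclideanSpace ℝ (Fin n))) (a : EuclideanSpace ℝ (Fin n)) :
    Set (Measure (EuclideanSpace ℝ (Fin n))) :=
  {ν | ν ≠ 0 ∧ IsLocallyFiniteMeasure ν ∧ ∃ c r : ℕ → ℝ,
    (∀ i, 0 < c i) ∧ (∀ i, 0 < r i) ∧ Tendsto r atTop (𝓝 0) ∧
    WeakStarTendsto (fun i => ENNReal.ofReal (c i) • blowup μ a (r i)) ν}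

/-- The pushforward of `μ` under `T^Λ_{p,r}(y) = Λ(p)⁻¹((y - p)/r)`. -/
noncomputable def blowupL {n : ℕ}
    (Λ : EuclideanSpace ℝ (Fin n) → (EuclideanSpace ℝ (Fin n) ≃L[ℝ] EuclideanSpace ℝ (Fin n)))
    (μ : Measure (EuclideanSpace ℝ (Fin n))) (p : EuclideanSpace ℝ (Fin n)) (r : ℝ) :
    Measure (EuclideanSpace ℝ (Fin n)) :=
  Measure.map (fun y => (Λ p).symm (r⁻¹ • (y - p))) μ

/-- The Λ-tangents of `μ` at `p`: nonzero Radon measures `ν` which are weak-* limits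
of `c_i T^Λ_{p,r_i}[μ]` for some `c_i > 0` and `r_i ↓ 0`. -/
def TanL {n : ℕ}
    (Λ : EuclideanSpace ℝ (Fin n) → (EuclideanSpace ℝ (Fin n) ≃L[ℝ] EuclideanSpace ℝ (Fin n)))
    (μ : Measure (EuclideanSpace ℝ (Fin n))) (p : EuclideanSpace ℝ (Fin n)) :
    Set (Measure (EuclideanSpace ℝ (Fin n))) :=
  {ν | ν ≠ 0 ∧ IsLocallyFiniteMeasure ν ∧ ∃ c r : ℕ → ℝ,
    (∀ i, 0 < c i) ∧ (∀ i, 0 < r i) ∧ Tendsto r atTop (𝓝 0) ∧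
    WeakStarTendsto (fun i => ENNReal.ofReal (c i) • blowupL Λ μ p (r i)) ν}

/-- The support of a measure: the set of points all of whose balls have positive measure. -/
def sptSet {n : ℕ} (ν : Measure (EuclideanSpace ℝ (Fin n))) : Set (EuclideanSpace ℝ (Fin n)) :=
  {x | ∀ ρ : ℝ, 0 < ρ → 0 < ν (ball x ρ)}

lemma abs_integral_sub_le {α : Type*} {_ : MeasurableSpace α} {σ : Measure α}
    {f g χ : α → ℝ} {ε : ℝ}
    (hf : Integrable f σ) (hg : Integrable g σ) (hχ : Integrable χ σ)
    (h : ∀ z, |f z - g z| ≤ ε * χ z) :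
    |∫ z, f z ∂σ - ∫ z, g z ∂σ| ≤ ε * ∫ z, χ z ∂σ := by
  rw [← integral_sub hf hg, ← integral_const_mul]
  exact (abs_integral_le_integral_abs).trans
    (integral_mono (hf.sub hg).abs (hχ.const_mul ε) h)

section TestFunctions

variable {E : Type*} [NormedAddCommGroup E]

/-- A continuous cutoff equal to `1` on `closedBall 0 R` and vanishing outside `ball 0 (R + 1)`. -/
noncomputable def plateau (R : ℝ) (z : E) : ℝ := max 0 (min 1 (R + 1 - ‖z‖))

lemma continuous_plateau (R : ℝ) : Continuous (plateau R : E → ℝ) := by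
  unfold plateau; fun_prop

lemma plateau_nonneg (R : ℝ) (z : E) : 0 ≤ plateau R z := le_max_left _ _

lemma plateau_eq_one {R : ℝ} {z : E} (hz : ‖z‖ ≤ R) : plateau R z = 1 := by
  rw [plateau, min_eq_left (by linarith), max_eq_right zero_le_one]

lemma plateau_eq_zero {R : ℝ} {z : E} (hz : R + 1 ≤ ‖z‖) : plateau R z = 0 :=
  max_eq_left ((min_le_right _ _).trans (by linarith))

lemma hasCompactSupport_plateau [ProperSpace E] (R : ℝ) :
    HasCompactSupport (plateau R : E → ℝ) :=
  HasCompactSupport.intro (isCompact_closedBall 0 (R + 1)) fun z hz => by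
    rw [mem_closedBall, dist_zero_right, not_le] at hz
    exact plateau_eq_zero hz.le

/-- A countable family of test functions which determines weak-* convergence. -/
structure IsDetermining (g : ℕ → E → ℝ) : Prop where
  continuous : ∀ j, Continuous (g j)
  hasCompactSupport : ∀ j, HasCompactSupport (g j)
  approx : ∀ f : E → ℝ, Continuous f → HasCompactSupport f →
    ∃ k, ∀ ε > 0, ∃ j, ∀ z, |f z - g j z| ≤ ε * g k z

lemma HasCompactSupport.exists_norm_bound {f : E → ℝ} (hf : HasCompactSupport f) :
    ∃ R : ℝ, ∀ z, f z ≠ 0 → ‖z‖ ≤ R := by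
  obtain ⟨R, hR⟩ := hf.isBounded.exists_norm_le
  exact ⟨R, fun z hz => hR z (subset_tsupport f hz)⟩

lemma exists_isDetermining [ProperSpace E] : ∃ g : ℕ → E → ℝ, IsDetermining g := by
  obtain ⟨T, hTc, hTd⟩ := TopologicalSpace.exists_countable_dense C(E, ℝ)
  have hTc' : (insert 1 T).Countable := hTc.insert 1
  have : Countable (insert 1 T : Set C(E, ℝ)) := hTc'.to_subtype
  have : Nonempty (insert 1 T : Set C(E, ℝ)) := ⟨⟨1, mem_insert _ _⟩⟩
  obtain ⟨e, he⟩ := exists_surjective_nat (ℕ × (insert 1 T : Set C(E, ℝ)))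
  refine ⟨fun j z => plateau (e j).1 z * (e j).2.1 z, fun j => ?_, fun j => ?_, ?_⟩
  · exact (continuous_plateau _).mul (e j).2.1.continuous
  · exact (hasCompactSupport_plateau _).mul_right
  · intro f hf hfc
    obtain ⟨R, hR⟩ := hfc.exists_norm_bound
    obtain ⟨N, hN⟩ := exists_nat_ge R
    obtain ⟨k, hk⟩ := he (N, ⟨1, mem_insert _ _⟩)
    refine ⟨k, fun ε hε => ?_⟩
    have hlim : Tendsto (fun g : C(E, ℝ) => g) (𝓝[T] ⟨f, hf⟩) (𝓝 ⟨f, hf⟩) :=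
      tendsto_id.mono_left nhdsWithin_le_nhds
    rw [ContinuousMap.tendsto_iff_forall_isCompact_tendstoUniformlyOn] at hlim
    have hev := Metric.tendstoUniformlyOn_iff.1
      (hlim _ (isCompact_closedBall 0 ((N : ℝ) + 1))) ε hε
    have : (𝓝[T] (⟨f, hf⟩ : C(E, ℝ))).NeBot := mem_closure_iff_nhdsWithin_neBot.1 (hTd _)
    obtain ⟨g, hg, hgT⟩ := (hev.and self_mem_nhdsWithin).exists
    obtain ⟨j, hj⟩ := he (N, ⟨g, mem_insert_of_mem _ hgT⟩)
    refine ⟨j, fun z => ?_⟩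
    simp only [hk, hj, ContinuousMap.one_apply, mul_one]
    have hfz : f z = plateau N z * f z := by
      by_cases hz : f z = 0
      · simp [hz]
      · rw [plateau_eq_one ((hR z hz).trans hN), one_mul]
    rw [hfz, ← mul_sub, abs_mul, abs_of_nonneg (plateau_nonneg _ _), mul_comm]
    by_cases hz : ‖z‖ ≤ N + 1
    · have := hg z (by simpa using hz)
      rw [Real.dist_eq] at this
      exact mul_le_mul_of_nonneg_right this.le (plateau_nonneg _ _)
    · rw [plateau_eq_zero (le_of_not_ge hz)]; simp

variable [MeasurableSpace E] [BorelSpace E]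

lemma tendsto_integral_of_approx {ι : Type*} {l : Filter ι} {σ : ι → Measure E} {ν : Measure E}
    [∀ i, IsFiniteMeasureOnCompacts (σ i)]
    (hconv : ∀ f : E → ℝ, Continuous f → HasCompactSupport f →
      Tendsto (fun i => ∫ x, f x ∂(σ i)) l (𝓝 (∫ x, f x ∂ν)))
    {φ : ι → E → ℝ} {φ₀ χ : E → ℝ} (hφ : ∀ i, Continuous (φ i))
    (hφ₀ : Continuous φ₀) (hφ₀c : HasCompactSupport φ₀)
    (hχ : Continuous χ) (hχc : HasCompactSupport χ)
    (h : ∀ ε > 0, ∀ᶠ i in l, ∀ z, |φ i z - φ₀ z| ≤ ε * χ z) :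
    Tendsto (fun i => ∫ x, φ i x ∂(σ i)) l (𝓝 (∫ x, φ₀ x ∂ν)) := by
  have key : Tendsto (fun i => ∫ x, φ i x ∂(σ i) - ∫ x, φ₀ x ∂(σ i)) l (𝓝 0) := by
    rw [Metric.tendsto_nhds]
    intro η hη
    set K : ℝ := |∫ x, χ x ∂ν| + 1 with hK
    have hKpos : 0 < K := by positivity
    have hχK : ∀ᶠ i in l, ∫ x, χ x ∂(σ i) < K :=
      (hconv χ hχ hχc).eventually_lt_const (by linarith [le_abs_self (∫ x, χ x ∂ν)])
    filter_upwards [hχK, h (η / (2 * K)) (by positivity)] with i hi1 hi2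
    have iφ₀ : Integrable φ₀ (σ i) := hφ₀.integrable_of_hasCompactSupport hφ₀c
    have iχ : Integrable χ (σ i) := hχ.integrable_of_hasCompactSupport hχc
    have iφ : Integrable (φ i) (σ i) := by
      refine (iφ₀.abs.add (iχ.const_mul (η / (2 * K)))).mono'
        (hφ i).aestronglyMeasurable (ae_of_all _ fun z => ?_)
      have h1 := hi2 z
      have h2 := abs_sub_abs_le_abs_sub (φ i z) (φ₀ z)
      simp only [Real.norm_eq_abs, Pi.add_apply]
      linarith
    rw [Real.dist_eq, sub_zero]
    calc _ ≤ η / (2 * K) * ∫ x, χ x ∂(σ i) := abs_integral_sub_le iφ iφ₀ iχ hi2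
      _ ≤ η / (2 * K) * K := by gcongr
      _ < η := by field_simp; linarith
  simpa using key.add (hconv φ₀ hφ₀ hφ₀c)

lemma IsDetermining.tendsto_integral {g : ℕ → E → ℝ} (hg : IsDetermining g)
    {ι : Type*} {l : Filter ι} {σ : ι → Measure E} {ν : Measure E}
    [∀ i, IsFiniteMeasureOnCompacts (σ i)] [IsFiniteMeasureOnCompacts ν]
    (hconv : ∀ j, Tendsto (fun i => ∫ x, g j x ∂(σ i)) l (𝓝 (∫ x, g j x ∂ν)))
    {f : E → ℝ} (hf : Continuous f) (hfc : HasCompactSupport f) :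
    Tendsto (fun i => ∫ x, f x ∂(σ i)) l (𝓝 (∫ x, f x ∂ν)) := by
  have integ : ∀ (τ : Measure E) [IsFiniteMeasureOnCompacts τ] (j : ℕ), Integrable (g j) τ :=
    fun τ _ j => (hg.continuous j).integrable_of_hasCompactSupport (hg.hasCompactSupport j)
  obtain ⟨k, hk⟩ := hg.approx f hf hfc
  rw [Metric.tendsto_nhds]
  intro η hη
  set K : ℝ := |∫ x, g k x ∂ν| + 1 with hK
  have hKpos : 0 < K := by positivity
  have hνK : ∫ x, g k x ∂ν < K := by linarith [le_abs_self (∫ x, g k x ∂ν)]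
  obtain ⟨j, hj⟩ := hk (η / (3 * K)) (by positivity)
  filter_upwards [(hconv k).eventually_lt_const hνK,
    Metric.tendsto_nhds.1 (hconv j) (η / 3) (by positivity)] with i hi1 hi2
  have b : ∀ (τ : Measure E) [IsFiniteMeasureOnCompacts τ], ∫ x, g k x ∂τ < K →
      |∫ x, f x ∂τ - ∫ x, g j x ∂τ| ≤ η / 3 := fun τ _ hτ =>
    calc _ ≤ η / (3 * K) * ∫ x, g k x ∂τ :=
          abs_integral_sub_le (hf.integrable_of_hasCompactSupport hfc) (integ τ j) (integ τ k) hj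
      _ ≤ η / (3 * K) * K := by gcongr
      _ = η / 3 := by field_simp
  have h1 := abs_le.1 (b (σ i) hi1)
  have h2 := abs_le.1 (b ν hνK)
  rw [Real.dist_eq, abs_lt] at hi2 ⊢
  constructor <;> linarith [h1.1, h1.2, h2.1, h2.2, hi2.1, hi2.2]

end TestFunctions

/-- Almost every point of an arbitrary set `A` is, for an arbitrary map `G` to a second countable
space, an outer density point of the part of `A` on which `G` is close to its value there. -/
lemma ae_exists_subset_density_one {n : ℕ} {Y : Type*} [TopologicalSpace Y]
    [SecondCountableTopology Y] (μ : Measure (EuclideanSpace ℝ (Fin n))) [IsLocallyFiniteMeasure μ]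
    (A : Set (EuclideanSpace ℝ (Fin n))) (G : EuclideanSpace ℝ (Fin n) → Y) :
    ∀ᵐ p ∂μ, p ∈ A → ∀ V ∈ 𝓝 (G p), ∃ B ⊆ A ∩ G ⁻¹' V,
      Tendsto (fun r => μ (B ∩ closedBall p r) / μ (closedBall p r)) (𝓝[>] 0) (𝓝 1) := by
  have h : ∀ᵐ p ∂μ, ∀ V ∈ TopologicalSpace.countableBasis Y, p ∈ A ∩ G ⁻¹' V →
      Tendsto (fun r => μ ((A ∩ G ⁻¹' V) ∩ closedBall p r) / μ (closedBall p r))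
        (𝓝[>] 0) (𝓝 1) :=
    (ae_ball_iff (TopologicalSpace.countable_countableBasis Y)).2 fun V _ =>
      ae_imp_of_ae_restrict (Besicovitch.ae_tendsto_measure_inter_div μ _)
  filter_upwards [h] with p hp hpA V hV
  obtain ⟨W, hW, hpW, hWV⟩ :=
    (TopologicalSpace.isBasis_countableBasis Y).mem_nhds_iff.1 hV
  exact ⟨A ∩ G ⁻¹' W, inter_subset_inter_right _ (preimage_mono hWV), hp W hW ⟨hpA, hpW⟩⟩

section Blowup

variable {n : ℕ} {μ ν : Measure (EuclideanSpace ℝ (Fin n))}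
  {Λ : EuclideanSpace ℝ (Fin n) → (EuclideanSpace ℝ (Fin n) ≃L[ℝ] EuclideanSpace ℝ (Fin n))}
  {p x : EuclideanSpace ℝ (Fin n)}

/-- The map `T^Λ_{p,r}` as a homeomorphism. -/
noncomputable def rescale
    (L : EuclideanSpace ℝ (Fin n) ≃L[ℝ] EuclideanSpace ℝ (Fin n))
    (p : EuclideanSpace ℝ (Fin n)) {r : ℝ} (hr : r ≠ 0) :
    EuclideanSpace ℝ (Fin n) ≃ₜ EuclideanSpace ℝ (Fin n) :=
  ((Homeomorph.subRight p).trans (Homeomorph.smulOfNeZero r⁻¹ (inv_ne_zero hr))).trans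
    L.symm.toHomeomorph

lemma blowupL_eq_map_rescale {r : ℝ} (hr : r ≠ 0) :
    blowupL Λ μ p r = Measure.map (rescale (Λ p) p hr) μ := rfl

lemma isFiniteMeasureOnCompacts_smul_blowupL [IsFiniteMeasureOnCompacts μ] (c : ℝ) {r : ℝ}
    (hr : r ≠ 0) : IsFiniteMeasureOnCompacts (ENNReal.ofReal c • blowupL Λ μ p r) := by
  rw [blowupL_eq_map_rescale hr]
  have := Measure.IsFiniteMeasureOnCompacts.map μ (rescale (Λ p) p hr)
  exact IsFiniteMeasureOnCompacts.smul _ ENNReal.ofReal_ne_top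

lemma integral_smul_blowupL {c : ℝ} (hc : 0 ≤ c) (r : ℝ) {f : EuclideanSpace ℝ (Fin n) → ℝ}
    (hf : Continuous f) :
    ∫ z, f z ∂(ENNReal.ofReal c • blowupL Λ μ p r) =
      c * ∫ y, f ((Λ p).symm (r⁻¹ • (y - p))) ∂μ := by
  rw [integral_smul_measure, ENNReal.toReal_ofReal hc, smul_eq_mul, blowupL,
    integral_map (by fun_prop) hf.aestronglyMeasurable]

lemma blowup_eq_blowupL (r : ℝ) :
    blowup ν x r = blowupL (fun _ => ContinuousLinearEquiv.refl ℝ _) ν x r := rfl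

lemma integral_smul_blowup {c : ℝ} (hc : 0 ≤ c) (r : ℝ) {f : EuclideanSpace ℝ (Fin n) → ℝ}
    (hf : Continuous f) :
    ∫ z, f z ∂(ENNReal.ofReal c • blowup ν x r) = c * ∫ y, f (r⁻¹ • (y - x)) ∂ν := by
  rw [blowup_eq_blowupL, integral_smul_blowupL hc r hf]; rfl

lemma integral_plateau_pos [IsFiniteMeasureOnCompacts ν] (hx : x ∈ sptSet ν) {δ : ℝ}
    (hδ : 0 < δ) : 0 < ∫ z, plateau (δ - 1) (z - x) ∂ν := by
  have hcont : Continuous fun z : EuclideanSpace ℝ (Fin n) => plateau (δ - 1) (z - x) :=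
    (continuous_plateau _).comp (by fun_prop)
  have hcs : HasCompactSupport fun z : EuclideanSpace ℝ (Fin n) => plateau (δ - 1) (z - x) :=
    (hasCompactSupport_plateau (δ - 1)).comp_homeomorph (Homeomorph.subRight x)
  rw [integral_pos_iff_support_of_nonneg (fun z => plateau_nonneg _ _)
    (hcont.integrable_of_hasCompactSupport hcs)]
  refine (hx δ hδ).trans_le (measure_mono fun z hz => ?_)
  rw [mem_ball, dist_eq_norm] at hz
  have : 0 < min 1 (δ - 1 + 1 - ‖z - x‖) := lt_min one_pos (by linarith)
  exact (lt_max_of_lt_right this).ne'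

/-- If rescalings of `μ` at `p` converge to `ν` and `x ∈ spt ν`, then every set with outer
density one at `p` meets the rescaled neighbourhoods of `x`. -/
lemma eventually_exists_mem_dist_lt [IsLocallyFiniteMeasure μ] [IsFiniteMeasureOnCompacts ν]
    {c r : ℕ → ℝ} (hc : ∀ i, 0 < c i) (hr : ∀ i, 0 < r i) (hr0 : Tendsto r atTop (𝓝 0))
    (hconv : WeakStarTendsto (fun i => ENNReal.ofReal (c i) • blowupL Λ μ p (r i)) ν)
    (hx : x ∈ sptSet ν) {B : Set (EuclideanSpace ℝ (Fin n))}
    (hB : Tendsto (fun r => μ (B ∩ closedBall p r) / μ (closedBall p r)) (𝓝[>] 0) (𝓝 1))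
    {δ' : ℝ} (hδ' : 0 < δ') :
    ∀ᶠ i in atTop, ∃ a ∈ B, dist ((r i)⁻¹ • (a - p)) (Λ p x) < δ' := by
  set L := Λ p with hL
  obtain ⟨δ, hδ, hLδ⟩ := Metric.continuous_iff.1 L.continuous x δ' hδ'
  set R : ℝ := ‖L x‖ + δ' with hR
  have hRpos : 0 < R := by positivity
  set Q : ℝ := ‖(L.symm : EuclideanSpace ℝ (Fin n) →L[ℝ] EuclideanSpace ℝ (Fin n))‖ * R with hQ
  set ψ : EuclideanSpace ℝ (Fin n) → ℝ := fun z => plateau (δ - 1) (z - x) with hψ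
  have hψc : Continuous ψ := (continuous_plateau _).comp (by fun_prop)
  have hψcs : HasCompactSupport ψ :=
    (hasCompactSupport_plateau (δ - 1)).comp_homeomorph (Homeomorph.subRight x)
  set β : ℝ := ∫ z, ψ z ∂ν with hβ
  have hβpos : 0 < β := integral_plateau_pos hx hδ
  set K : ℝ := ∫ z, plateau Q z ∂ν + 1 with hK
  have hKpos : 0 < K := by
    have : 0 ≤ ∫ z, plateau Q z ∂ν := integral_nonneg fun z => plateau_nonneg Q z
    linarith
  set η : ℝ := β / (2 * K) with hη
  have hηpos : 0 < η := by positivity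
  have hRr : Tendsto (fun i => R * r i) atTop (𝓝[>] 0) := by
    refine tendsto_nhdsWithin_iff.2 ⟨?_, Eventually.of_forall fun i => mul_pos hRpos (hr i)⟩
    simpa using hr0.const_mul R
  have hdens : Tendsto
      (fun i => μ.real (B ∩ closedBall p (R * r i)) / μ.real (closedBall p (R * r i)))
      atTop (𝓝 1) := by
    have := (ENNReal.tendsto_toReal ENNReal.one_ne_top).comp (hB.comp hRr)
    simpa [Function.comp_def, Measure.real, ENNReal.toReal_div] using this
  filter_upwards [(hconv ψ hψc hψcs).eventually_const_lt (half_lt_self hβpos),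
    (hconv _ (continuous_plateau Q) (hasCompactSupport_plateau Q)).eventually_lt_const
      (lt_add_one _), hdens.eventually_const_lt (sub_lt_self 1 hηpos)] with i h1 h2 h3
  rw [integral_smul_blowupL (hc i).le _ hψc] at h1
  rw [integral_smul_blowupL (hc i).le _ (continuous_plateau Q)] at h2
  have hri := hr i
  have integ : ∀ f : EuclideanSpace ℝ (Fin n) → ℝ, Continuous f → HasCompactSupport f →
      Integrable (fun y => f (L.symm ((r i)⁻¹ • (y - p)))) μ := fun f hf hfc =>
    (hf.comp (rescale L p hri.ne').continuous).integrable_of_hasCompactSupport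
      (hfc.comp_homeomorph (rescale L p hri.ne'))
  set U : Set (EuclideanSpace ℝ (Fin n)) := {y | dist ((r i)⁻¹ • (y - p)) (L x) < δ'} with hU
  have hUo : IsOpen U := isOpen_lt (by fun_prop) continuous_const
  set D := closedBall p (R * r i) with hD
  have hDfin : μ D ≠ ⊤ := measure_closedBall_lt_top.ne
  have mem_D : ∀ y, y ∈ D ↔ ‖(r i)⁻¹ • (y - p)‖ ≤ R := fun y => by
    rw [hD, mem_closedBall, dist_eq_norm, norm_smul, Real.norm_of_nonneg (by positivity),
      inv_mul_le_iff₀ hri, mul_comm]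
  have hUD : U ⊆ D := fun y hy => by
    rw [mem_D]
    have hy' : ‖(r i)⁻¹ • (y - p) - L x‖ < δ' := by rw [← dist_eq_norm]; exact hy
    have := norm_sub_norm_le ((r i)⁻¹ • (y - p)) (L x)
    linarith
  have hUfin : μ U ≠ ⊤ := measure_ne_top_of_subset hUD hDfin
  have hψU : ∫ y, ψ (L.symm ((r i)⁻¹ • (y - p))) ∂μ ≤ μ.real U := by
    rw [← integral_indicator_one hUo.measurableSet]
    refine integral_mono (integ ψ hψc hψcs)
      ((integrable_indicator_iff hUo.measurableSet).2 (integrableOn_const hUfin)) fun y => ?_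
    by_cases hy : y ∈ U
    · rw [indicator_of_mem hy]
      exact max_le zero_le_one (min_le_left _ _)
    · rw [indicator_of_notMem hy]
      refine (plateau_eq_zero ?_).le
      by_contra! hlt
      refine hy ?_
      have := hLδ (L.symm ((r i)⁻¹ • (y - p))) (by rw [dist_eq_norm]; linarith)
      rwa [ContinuousLinearEquiv.apply_symm_apply] at this
  have hDQ : μ.real D ≤ ∫ y, plateau Q (L.symm ((r i)⁻¹ • (y - p))) ∂μ := by
    rw [← integral_indicator_one measurableSet_closedBall]
    refine integral_mono ((integrable_indicator_iff measurableSet_closedBall).2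
      (integrableOn_const hDfin))
      (integ _ (continuous_plateau Q) (hasCompactSupport_plateau Q)) fun y => ?_
    by_cases hy : y ∈ D
    · rw [indicator_of_mem hy]
      refine (plateau_eq_one ?_).ge
      refine ((L.symm : EuclideanSpace ℝ (Fin n) →L[ℝ] EuclideanSpace ℝ (Fin n)).le_opNorm
        _).trans ?_
      rw [hQ]
      gcongr
      exact (mem_D y).1 hy
    · rw [indicator_of_notMem hy]
      exact plateau_nonneg _ _
  have hci := hc i
  have hηD : η * μ.real D < μ.real U := by
    refine lt_of_mul_lt_mul_left ?_ hci.le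
    calc c i * (η * μ.real D) = η * (c i * μ.real D) := by ring
      _ ≤ η * K := by
        gcongr
        exact (mul_le_mul_of_nonneg_left hDQ hci.le).trans h2.le
      _ = β / 2 := by rw [hη]; field_simp
      _ < c i * μ.real U := h1.trans_le (mul_le_mul_of_nonneg_left hψU hci.le)
  have hDpos : 0 < μ.real D := by
    have : 0 ≤ η * μ.real D := by positivity
    exact (this.trans_lt hηD).trans_le (measureReal_mono hUD hDfin)
  rw [lt_div_iff₀ hDpos] at h3
  by_contra! hcon
  have hsub : B ∩ D ⊆ D \ U := fun y hy => ⟨hy.2, fun hyU => absurd hyU (hcon y hy.1).not_gt⟩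
  have h4 : μ.real (B ∩ D) ≤ μ.real (D \ U) :=
    measureReal_mono hsub (measure_ne_top_of_subset sdiff_subset hDfin)
  have h5 := measureReal_sdiff_add_inter (μ := μ) (s := D) hUo.measurableSet hDfin
  rw [inter_eq_self_of_subset_right hUD] at h5
  linarith

/-- Rescaling by a linear map close to the inverse of `L` about a point close to `L x` approximates
translation by `x`, uniformly when tested against a fixed test function. -/
lemma exists_eventually_abs_sub_le_plateau {f : EuclideanSpace ℝ (Fin n) → ℝ} (hf : Continuous f)
    (hfc : HasCompactSupport f)
    (L : EuclideanSpace ℝ (Fin n) ≃L[ℝ] EuclideanSpace ℝ (Fin n))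
    (x : EuclideanSpace ℝ (Fin n)) {ρ : ℝ} (hρ : 0 < ρ) :
    ∃ Q : ℝ, ∀ ε > 0, ∀ᶠ y : EuclideanSpace ℝ (Fin n) ×
        (EuclideanSpace ℝ (Fin n) →L[ℝ] EuclideanSpace ℝ (Fin n)) ×
        (EuclideanSpace ℝ (Fin n) →L[ℝ] EuclideanSpace ℝ (Fin n)) in
        𝓝 (L x, (L : EuclideanSpace ℝ (Fin n) →L[ℝ] EuclideanSpace ℝ (Fin n)),
          (L.symm : EuclideanSpace ℝ (Fin n) →L[ℝ] EuclideanSpace ℝ (Fin n))),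
      (∀ z, y.2.1 (y.2.2 z) = z) →
        ∀ z, |f (ρ⁻¹ • y.2.2 (L z - y.1)) - f (ρ⁻¹ • (z - x))| ≤ ε * plateau Q z := by
  obtain ⟨R, hR⟩ := hfc.exists_norm_bound
  set y₀ : EuclideanSpace ℝ (Fin n) ×
        (EuclideanSpace ℝ (Fin n) →L[ℝ] EuclideanSpace ℝ (Fin n)) ×
        (EuclideanSpace ℝ (Fin n) →L[ℝ] EuclideanSpace ℝ (Fin n)) := (L x, L, L.symm) with hy₀
  set Q : ℝ := ‖y₀.2.2‖ * ((‖y₀.2.1‖ + 1) * (ρ * R) + (‖y₀.1‖ + 1)) with hQ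
  have bound : ∀ y : EuclideanSpace ℝ (Fin n) ×
        (EuclideanSpace ℝ (Fin n) →L[ℝ] EuclideanSpace ℝ (Fin n)) ×
        (EuclideanSpace ℝ (Fin n) →L[ℝ] EuclideanSpace ℝ (Fin n)),
      ‖y.1‖ ≤ ‖y₀.1‖ + 1 → ‖y.2.1‖ ≤ ‖y₀.2.1‖ + 1 → (∀ z, y.2.1 (y.2.2 z) = z) →
      ∀ z, f (ρ⁻¹ • y.2.2 (L z - y.1)) ≠ 0 → ‖z‖ ≤ Q := by
    intro y hy1 hy2 hinv z hz
    have h1 := hR _ hz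
    rw [norm_smul, Real.norm_of_nonneg (by positivity), inv_mul_le_iff₀ hρ] at h1
    have h2 : ‖L z - y.1‖ ≤ (‖y₀.2.1‖ + 1) * (ρ * R) := by
      calc ‖L z - y.1‖ = ‖y.2.1 (y.2.2 (L z - y.1))‖ := by rw [hinv]
        _ ≤ ‖y.2.1‖ * ‖y.2.2 (L z - y.1)‖ := y.2.1.le_opNorm _
        _ ≤ _ := mul_le_mul hy2 h1 (norm_nonneg _) (by positivity)
    have h3 : ‖L z‖ ≤ (‖y₀.2.1‖ + 1) * (ρ * R) + (‖y₀.1‖ + 1) := by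
      have := norm_sub_norm_le (L z) y.1
      linarith
    calc ‖z‖ = ‖y₀.2.2 (L z)‖ := by simp [hy₀]
      _ ≤ ‖y₀.2.2‖ * ‖L z‖ := y₀.2.2.le_opNorm _
      _ ≤ Q := by rw [hQ]; gcongr
  have hlim : ∀ z, y₀.2.2 (L z - y₀.1) = z - x := fun z => by simp [hy₀]
  refine ⟨Q, fun ε hε => ?_⟩
  obtain ⟨v, hv, hvε⟩ := IsCompact.mem_uniformity_of_prod
    (isCompact_closedBall (0 : EuclideanSpace ℝ (Fin n)) Q)
    (f := fun (y : EuclideanSpace ℝ (Fin n) ×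
        (EuclideanSpace ℝ (Fin n) →L[ℝ] EuclideanSpace ℝ (Fin n)) ×
        (EuclideanSpace ℝ (Fin n) →L[ℝ] EuclideanSpace ℝ (Fin n))) z =>
        f (ρ⁻¹ • y.2.2 (L z - y.1)))
    (s := univ) (q := y₀) (by unfold Function.uncurry; fun_prop) (mem_univ _)
    (Metric.dist_mem_uniformity hε)
  rw [nhdsWithin_univ] at hv
  have e1 : ∀ᶠ y in 𝓝 y₀, ‖y.1‖ < ‖y₀.1‖ + 1 :=
    (continuous_fst.norm.tendsto y₀).eventually_lt_const (lt_add_one _)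
  have e2 : ∀ᶠ y in 𝓝 y₀, ‖y.2.1‖ < ‖y₀.2.1‖ + 1 :=
    ((continuous_fst.comp continuous_snd).norm.tendsto y₀).eventually_lt_const (lt_add_one _)
  filter_upwards [hv, e1, e2] with y hyv hy1 hy2 hinv z
  rw [← hlim z]
  by_cases hz : ‖z‖ ≤ Q
  · rw [plateau_eq_one hz, mul_one]
    have := hvε y hyv z (by simpa using hz)
    exact (show dist _ _ < ε from this).le
  · have z1 : f (ρ⁻¹ • y.2.2 (L z - y.1)) = 0 := by
      by_contra h
      exact hz (bound y hy1.le hy2.le hinv z h)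
    have z2 : f (ρ⁻¹ • y₀.2.2 (L z - y₀.1)) = 0 := by
      by_contra h
      exact hz (bound y₀ (by linarith) (by linarith) (fun z => by simp [hy₀]) z h)
    rw [z1, z2, sub_zero, abs_zero]
    exact mul_nonneg hε.le (plateau_nonneg _ _)

/-- The integrals of a family of test functions against a measure. -/
noncomputable def moments (g : ℕ → EuclideanSpace ℝ (Fin n) → ℝ)
    (σ : Measure (EuclideanSpace ℝ (Fin n))) : ℕ → ℝ := fun j => ∫ z, g j z ∂σ

/-- The moments of the rescalings of `μ` at `p` at scales below `ε`. -/
def blowupMoments (g : ℕ → EuclideanSpace ℝ (Fin n) → ℝ)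
    (Λ : EuclideanSpace ℝ (Fin n) → (EuclideanSpace ℝ (Fin n) ≃L[ℝ] EuclideanSpace ℝ (Fin n)))
    (μ : Measure (EuclideanSpace ℝ (Fin n))) (p : EuclideanSpace ℝ (Fin n)) (ε : ℝ) :
    Set (ℕ → ℝ) :=
  {m | ∃ c r : ℝ, 0 < c ∧ 0 < r ∧ r < ε ∧
    moments g (ENNReal.ofReal c • blowupL Λ μ p r) = m}

lemma mem_TanL_of_moments [IsFiniteMeasureOnCompacts μ] {g : ℕ → EuclideanSpace ℝ (Fin n) → ℝ}
    (hg : IsDetermining g) (hν : ν ≠ 0) [IsLocallyFiniteMeasure ν]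
    (h : ∀ ε > 0, moments g ν ∈ closure (blowupMoments g Λ μ p ε)) : ν ∈ TanL Λ μ p := by
  obtain ⟨V, hV⟩ := (𝓝 (moments g ν)).exists_antitone_basis
  have hne : ∀ k : ℕ, (V k ∩ blowupMoments g Λ μ p (1 / ((k : ℝ) + 1))).Nonempty := fun k =>
    mem_closure_iff_nhds.1 (h _ Nat.one_div_pos_of_nat) _ (hV.1.mem_of_mem trivial)
  choose m hmV c r hc hr hrlt hm using hne
  refine ⟨hν, inferInstance, c, r, hc, hr, ?_, fun f hf hfc => ?_⟩
  · exact squeeze_zero (fun k => (hr k).le) (fun k => (hrlt k).le)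
      tendsto_one_div_add_atTop_nhds_zero_nat
  · have := fun i => isFiniteMeasureOnCompacts_smul_blowupL (Λ := Λ) (μ := μ) (p := p) (c i)
      (hr i).ne'
    refine hg.tendsto_integral (fun j => ?_) hf hfc
    have hlim := tendsto_pi_nhds.1 (hV.tendsto hmV) j
    simpa only [← hm, moments] using hlim

lemma exists_mem_moments_blowupL_mem [IsLocallyFiniteMeasure μ]
    {g : ℕ → EuclideanSpace ℝ (Fin n) → ℝ} (hg : IsDetermining g)
    {A : Set (EuclideanSpace ℝ (Fin n))}
    (hA : ∀ V ∈ 𝓝 ((Λ p : EuclideanSpace ℝ (Fin n) →L[ℝ] EuclideanSpace ℝ (Fin n)),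
        ((Λ p).symm : EuclideanSpace ℝ (Fin n) →L[ℝ] EuclideanSpace ℝ (Fin n))),
      ∃ B ⊆ A ∩ (fun a => ((Λ a : EuclideanSpace ℝ (Fin n) →L[ℝ] EuclideanSpace ℝ (Fin n)),
        ((Λ a).symm : EuclideanSpace ℝ (Fin n) →L[ℝ] EuclideanSpace ℝ (Fin n)))) ⁻¹' V,
      Tendsto (fun r => μ (B ∩ closedBall p r) / μ (closedBall p r)) (𝓝[>] 0) (𝓝 1))
    (hν : ν ∈ TanL Λ μ p) (hx : x ∈ sptSet ν) {ρ c : ℝ} (hρ : 0 < ρ) (hc : 0 < c)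
    {U : Set (ℕ → ℝ)} (hU : IsOpen U) (hmem : moments g (ENNReal.ofReal c • blowup ν x ρ) ∈ U)
    {ε : ℝ} (hε : 0 < ε) : ∃ a ∈ A, (U ∩ blowupMoments g Λ μ a ε).Nonempty := by
  obtain ⟨-, hνfin, cs, rs, hcs, hrs, hrs0, hconv⟩ := hν
  set G := fun a => ((Λ a : EuclideanSpace ℝ (Fin n) →L[ℝ] EuclideanSpace ℝ (Fin n)),
    ((Λ a).symm : EuclideanSpace ℝ (Fin n) →L[ℝ] EuclideanSpace ℝ (Fin n))) with hG
  set q := fun k : ℕ × EuclideanSpace ℝ (Fin n) =>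
    (k.1, (rs k.1)⁻¹ • (k.2 - p), G k.2) with hq
  set l : Filter (ℕ × EuclideanSpace ℝ (Fin n)) :=
    comap q (atTop ×ˢ 𝓝 (Λ p x, G p)) ⊓ 𝓟 {k | k.2 ∈ A} with hl
  have hne : l.NeBot := by
    rw [hl, inf_principal_neBot_iff]
    intro s hs
    obtain ⟨t, ht, hts⟩ := mem_comap.1 hs
    obtain ⟨N, hN, t₂, ht₂, hNt⟩ := mem_prod_iff.1 ht
    rw [nhds_prod_eq] at ht₂
    obtain ⟨W, hW, V, hV, hWV⟩ := mem_prod_iff.1 ht₂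
    obtain ⟨δ, hδ, hδW⟩ := Metric.mem_nhds_iff.1 hW
    obtain ⟨B, hBA, hB⟩ := hA V hV
    obtain ⟨i, ⟨a, haB, hai⟩, hiN⟩ :=
      ((eventually_exists_mem_dist_lt hcs hrs hrs0 hconv hx hB hδ).and hN).exists
    exact ⟨(i, a), hts (hNt ⟨hiN, hWV ⟨hδW hai, (hBA haB).2⟩⟩), (hBA haB).1⟩
  have hlq : Tendsto q l (atTop ×ˢ 𝓝 (Λ p x, G p)) := tendsto_comap.mono_left inf_le_left
  have hl1 : Tendsto Prod.fst l atTop := hlq.fst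
  have hl2 : Tendsto (fun k => (q k).2) l (𝓝 (Λ p x, G p)) := hlq.snd
  have hlA : ∀ᶠ k in l, k.2 ∈ A := mem_inf_of_right (mem_principal_self _)
  have hlim : Tendsto (fun k : ℕ × EuclideanSpace ℝ (Fin n) =>
      moments g (ENNReal.ofReal (c * cs k.1) • blowupL Λ μ k.2 (rs k.1 * ρ))) l
      (𝓝 (moments g (ENNReal.ofReal c • blowup ν x ρ))) := by
    refine tendsto_pi_nhds.2 fun j => ?_
    have hgj := hg.continuous j
    obtain ⟨Q, hQ⟩ := exists_eventually_abs_sub_le_plateau hgj (hg.hasCompactSupport j)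
      (Λ p) x hρ
    have := fun k : ℕ × EuclideanSpace ℝ (Fin n) =>
      isFiniteMeasureOnCompacts_smul_blowupL (Λ := Λ) (μ := μ) (p := p) (cs k.1) (hrs k.1).ne'
    have hmain : Tendsto (fun k : ℕ × EuclideanSpace ℝ (Fin n) =>
        ∫ z, g j (ρ⁻¹ • (Λ k.2).symm (Λ p z - (rs k.1)⁻¹ • (k.2 - p)))
          ∂(ENNReal.ofReal (cs k.1) • blowupL Λ μ p (rs k.1))) l
        (𝓝 (∫ z, g j (ρ⁻¹ • (z - x)) ∂ν)) := by
      refine tendsto_integral_of_approx (χ := plateau Q)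
        (fun f hf hfc => (hconv f hf hfc).comp hl1) (fun k => by fun_prop) (by fun_prop) ?_
        (continuous_plateau Q) (hasCompactSupport_plateau Q) fun η hη => ?_
      · exact (hg.hasCompactSupport j).comp_homeomorph
          (rescale (ContinuousLinearEquiv.refl ℝ _) x hρ.ne')
      · filter_upwards [hl2.eventually (hQ η hη)] with k hk
        exact hk fun z => by simp [hq, hG]
    simp only [moments]
    rw [integral_smul_blowup hc.le _ hgj]
    refine (hmain.const_mul c).congr fun k => ?_
    rw [integral_smul_blowupL (hcs _).le _ (by fun_prop),
      integral_smul_blowupL (mul_pos hc (hcs _)).le _ hgj, mul_assoc]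
    congr 3
    ext y
    congr 1
    rw [ContinuousLinearEquiv.apply_symm_apply, ← smul_sub, ← map_smul, smul_smul, mul_inv_rev]
    congr 2
    abel
  have hsmall : ∀ᶠ k in l, rs k.1 * ρ < ε := by
    have : Tendsto (fun k : ℕ × EuclideanSpace ℝ (Fin n) => rs k.1 * ρ) l (𝓝 (0 * ρ)) :=
      (hrs0.comp hl1).mul_const ρ
    rw [zero_mul] at this
    exact this.eventually_lt_const hε
  obtain ⟨k, ⟨hkU, hkA⟩, hkε⟩ :=
    (((hlim.eventually (hU.mem_nhds hmem)).and hlA).and hsmall).exists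
  exact ⟨k.2, hkA, _, hkU, _, _, mul_pos hc (hcs _), mul_pos (hrs _) hρ, hkε, rfl⟩

lemma ae_moments_blowup_mem_closure (μ : Measure (EuclideanSpace ℝ (Fin n)))
    [IsLocallyFiniteMeasure μ]
    (Λ : EuclideanSpace ℝ (Fin n) → (EuclideanSpace ℝ (Fin n) ≃L[ℝ] EuclideanSpace ℝ (Fin n)))
    {g : ℕ → EuclideanSpace ℝ (Fin n) → ℝ} (hg : IsDetermining g) :
    ∀ᵐ p ∂μ, ∀ ν ∈ TanL Λ μ p, ∀ x ∈ sptSet ν, ∀ ρ > 0, ∀ c > 0, ∀ ε > 0,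
      moments g (ENNReal.ofReal c • blowup ν x ρ) ∈ closure (blowupMoments g Λ μ p ε) := by
  set A : Set (ℕ → ℝ) → ℕ → Set (EuclideanSpace ℝ (Fin n)) := fun U m =>
    {p | (∃ ν ∈ TanL Λ μ p, ∃ x ∈ sptSet ν, ∃ ρ > 0, ∃ c > 0,
      moments g (ENNReal.ofReal c • blowup ν x ρ) ∈ U) ∧
      ¬ (U ∩ blowupMoments g Λ μ p (1 / ((m : ℝ) + 1))).Nonempty} with hA
  have hbasis := TopologicalSpace.isBasis_countableBasis (ℕ → ℝ)
  have hae : ∀ᵐ p ∂μ, ∀ U ∈ TopologicalSpace.countableBasis (ℕ → ℝ), ∀ m : ℕ, p ∉ A U m := by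
    rw [ae_ball_iff (TopologicalSpace.countable_countableBasis _)]
    intro U hU
    rw [ae_all_iff]
    intro m
    filter_upwards [ae_exists_subset_density_one μ (A U m) fun a =>
      ((Λ a : EuclideanSpace ℝ (Fin n) →L[ℝ] EuclideanSpace ℝ (Fin n)),
        ((Λ a).symm : EuclideanSpace ℝ (Fin n) →L[ℝ] EuclideanSpace ℝ (Fin n)))] with p hp hpA
    obtain ⟨ν, hν, x, hx, ρ, hρ, c, hc, hmem⟩ := hpA.1
    obtain ⟨a, ha, hne⟩ := exists_mem_moments_blowupL_mem hg (hp hpA) hν hx hρ hc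
      (hbasis.isOpen hU) hmem (Nat.one_div_pos_of_nat (n := m))
    exact ha.2 hne
  filter_upwards [hae] with p hp ν hν x hx ρ hρ c hc ε hε
  obtain ⟨m, hm⟩ := exists_nat_one_div_lt hε
  refine closure_mono (s := blowupMoments g Λ μ p (1 / ((m : ℝ) + 1))) ?_ ?_
  · rintro _ ⟨c, r, hc, hr, hrlt, rfl⟩
    exact ⟨c, r, hc, hr, hrlt.trans hm, rfl⟩
  · rw [hbasis.mem_closure_iff]
    intro U hU hmem
    by_contra hne
    exact hp U hU m ⟨⟨ν, hν, x, hx, ρ, hρ, c, hc, hmem⟩, hne⟩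

end Blowup

/-- Tangents to Λ-tangents are Λ-tangents: for `μ`-a.e. `p`, every `ν ∈ Tan_Λ(μ,p)` satisfies
(1) `T_{x,r}[ν] ∈ Tan_Λ(μ,p)` for every `x ∈ spt ν` and `r > 0`, and
(2) `Tan(ν,x) ⊆ Tan_Λ(μ,p)` for every `x ∈ spt ν`. -/
theorem tangents_to_Lambda_tangents {n : ℕ}
    (μ : Measure (EuclideanSpace ℝ (Fin n))) [IsLocallyFiniteMeasure μ]
    (Λ : EuclideanSpace ℝ (Fin n) → (EuclideanSpace ℝ (Fin n) ≃L[ℝ] EuclideanSpace ℝ (Fin n)))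
    (hΛ : ∀ v : EuclideanSpace ℝ (Fin n), Measurable fun p => Λ p v) :
    ∀ᵐ p ∂μ, ∀ ν ∈ TanL Λ μ p,
      (∀ x ∈ sptSet ν, ∀ r : ℝ, 0 < r → blowup ν x r ∈ TanL Λ μ p) ∧
      (∀ x ∈ sptSet ν, TanM ν x ⊆ TanL Λ μ p) := by
  obtain ⟨g, hg⟩ := exists_isDetermining (E := EuclideanSpace ℝ (Fin n))
  filter_upwards [ae_moments_blowup_mem_closure μ Λ hg] with p hp ν hν
  have hνfin : IsLocallyFiniteMeasure ν := hν.2.1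
  refine ⟨fun x hx r hr => ?_, fun x hx τ hτ => ?_⟩
  · have hfin : IsFiniteMeasureOnCompacts (blowup ν x r) := by
      rw [blowup_eq_blowupL, blowupL_eq_map_rescale hr.ne']
      exact Measure.IsFiniteMeasureOnCompacts.map ν _
    refine mem_TanL_of_moments hg ?_ fun ε hε => ?_
    · rw [blowup_eq_blowupL, blowupL_eq_map_rescale hr.ne', ne_eq,
        Measure.map_eq_zero_iff (Homeomorph.measurable _).aemeasurable]
      exact hν.1
    · simpa using hp ν hν x hx r hr 1 one_pos ε hε
  · obtain ⟨hτ0, hτfin, c, r, hc, hr, -, hconv⟩ := hτ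
    refine mem_TanL_of_moments hg hτ0 fun ε hε => ?_
    have hlim : Tendsto (fun i => moments g (ENNReal.ofReal (c i) • blowup ν x (r i))) atTop
        (𝓝 (moments g τ)) :=
      tendsto_pi_nhds.2 fun j => hconv _ (hg.continuous j) (hg.hasCompactSupport j)
    exact isClosed_closure.mem_of_tendsto hlim
      (Eventually.of_forall fun i => hp ν hν x hx (r i) (hr i) (c i) (hc i) ε hε)
end

section
/- Let μ be a Radon measure on ℝⁿ and Λ : ℝⁿ → GL(n,ℝ). Suppose 𝓕 = ⋃_{i=1}^∞ 𝓕_i, where each 𝓕_i is a d-cone with compact basis, and suppose there exists a d-cone M with closed basis such that 𝓕 ⊆ M and for each i the following property (P_i) holds: there exist ε_i > 0 and R_i > 0 such that for every ε ∈ (0, ε_i) there is no ν ∈ M ∖ ⋃_{j=1}^{i−1} 𝓕_j satisfying d_r(ν, 𝓕_i) ≤ ε for all r ≥ R_i and d_{R_i}(ν, 𝓕_i) = ε. Then for every p ∈ ℝⁿ with Tan_Λ(μ,p) ⊆ M, either Tan_Λ(μ,p) ⊆ 𝓕 or Tan_Λ(μ,p) ∩ 𝓕 = ∅. -/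
open MeasureTheory Metric Filter Topology Set

/-- `F_K(μ,ν)`: the supremum of `|∫ f dμ - ∫ f dν|` over continuous `1`-Lipschitz
functions `f` with compact support contained in `K`. -/
noncomputable def FK {n : ℕ} (K : Set (EuclideanSpace ℝ (Fin n)))
    (μ ν : Measure (EuclideanSpace ℝ (Fin n))) : ℝ :=
  sSup {d : ℝ | ∃ f : EuclideanSpace ℝ (Fin n) → ℝ, Continuous f ∧ LipschitzWith 1 f ∧
    HasCompactSupport f ∧ tsupport f ⊆ K ∧ d = |(∫ x, f x ∂μ) - ∫ x, f x ∂ν|}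

/-- `F_r := F_K` for `K` the closed ball of radius `r` centered at the origin. -/
noncomputable def Fr {n : ℕ} (r : ℝ) (μ ν : Measure (EuclideanSpace ℝ (Fin n))) : ℝ :=
  FK (closedBall 0 r) μ ν

/-- `F_r(μ) := F_r(μ, 0)`. -/
noncomputable def Fb {n : ℕ} (r : ℝ) (μ : Measure (EuclideanSpace ℝ (Fin n))) : ℝ :=
  Fr r μ 0

/-- A collection `M` of nonzero Radon measures is a d-cone if it is invariant under
multiplication by positive constants and under the dilations `T_{0,r}`. -/
def IsDCone {n : ℕ} (M : Set (Measure (EuclideanSpace ℝ (Fin n)))) : Prop :=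
  (∀ μ ∈ M, μ ≠ 0 ∧ IsLocallyFiniteMeasure μ) ∧
  (∀ μ ∈ M, ∀ c : ℝ, 0 < c → ENNReal.ofReal c • μ ∈ M) ∧
  (∀ μ ∈ M, ∀ r : ℝ, 0 < r → blowup μ 0 r ∈ M)

/-- The distance `d_s(ν, M)` between `ν` and the d-cone `M` at scale `s`:
`inf { F_s(ν / F_s(ν), μ) : μ ∈ M, F_s(μ) = 1 }` when `0 < F_s(ν) < ∞`, and `1` otherwise. -/
noncomputable def dCone {n : ℕ} (s : ℝ) (ν : Measure (EuclideanSpace ℝ (Fin n)))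
    (M : Set (Measure (EuclideanSpace ℝ (Fin n)))) : ℝ :=
  if Fb s ν = 0 then 1 else
    sInf {d : ℝ | ∃ μ ∈ M, Fb s μ = 1 ∧ d = Fr s ((ENNReal.ofReal (Fb s ν))⁻¹ • ν) μ}

/-- The basis of a d-cone: the elements `μ` with `F_1(μ) = 1`. -/
def coneBasis {n : ℕ} (M : Set (Measure (EuclideanSpace ℝ (Fin n)))) :
    Set (Measure (EuclideanSpace ℝ (Fin n))) :=
  {μ ∈ M | Fb 1 μ = 1}

/-- A d-cone has compact basis if every sequence in its basis has a subsequence converging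
weak-* to an element of the basis. -/
def HasCompactBasis {n : ℕ} (M : Set (Measure (EuclideanSpace ℝ (Fin n)))) : Prop :=
  ∀ μ : ℕ → Measure (EuclideanSpace ℝ (Fin n)), (∀ k, μ k ∈ coneBasis M) →
    ∃ ν ∈ coneBasis M, ∃ φ : ℕ → ℕ, StrictMono φ ∧ WeakStarTendsto (fun k => μ (φ k)) ν

/-- A d-cone has closed basis if its basis is closed under weak-* limits. -/
def HasClosedBasis {n : ℕ} (M : Set (Measure (EuclideanSpace ℝ (Fin n)))) : Prop :=
  ∀ μ : ℕ → Measure (EuclideanSpace ℝ (Fin n)), (∀ k, μ k ∈ coneBasis M) →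
    ∀ ν : Measure (EuclideanSpace ℝ (Fin n)), WeakStarTendsto μ ν → ν ∈ coneBasis M

namespace TangentCone

section Distance

variable {n : ℕ} {r s c : ℝ} {f : EuclideanSpace ℝ (Fin n) → ℝ}
  {μ ν ρ : Measure (EuclideanSpace ℝ (Fin n))}

/-- The test functions in the definition of `F_r`: `1`-Lipschitz functions vanishing outside the
closed ball of radius `r`. -/
def IsTest (r : ℝ) (f : EuclideanSpace ℝ (Fin n) → ℝ) : Prop :=
  LipschitzWith 1 f ∧ ∀ x, r < ‖x‖ → f x = 0

lemma IsTest.tsupport_subset (hf : IsTest r f) : tsupport f ⊆ closedBall 0 r := by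
  refine closure_minimal (fun x hx => ?_) isClosed_closedBall
  rw [mem_closedBall_zero_iff]
  by_contra h
  exact hx (hf.2 x (not_le.1 h))

lemma IsTest.hasCompactSupport (hf : IsTest r f) : HasCompactSupport f :=
  HasCompactSupport.of_support_subset_isCompact (isCompact_closedBall 0 r)
    ((subset_tsupport f).trans hf.tsupport_subset)

lemma IsTest.continuous (hf : IsTest r f) : Continuous f := hf.1.continuous

lemma IsTest.mono (hf : IsTest r f) (h : r ≤ s) : IsTest s f :=
  ⟨hf.1, fun x hx => hf.2 x (h.trans_lt hx)⟩

lemma isTest_zero : IsTest r (fun _ : EuclideanSpace ℝ (Fin n) => (0 : ℝ)) :=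
  ⟨LipschitzWith.const' 0, fun _ _ => rfl⟩

lemma IsTest.integrable (hf : IsTest r f) [IsLocallyFiniteMeasure μ] : Integrable f μ :=
  hf.continuous.integrable_of_hasCompactSupport hf.hasCompactSupport

lemma isTest_cone (r : ℝ) :
    IsTest r (fun x : EuclideanSpace ℝ (Fin n) => max (r - ‖x‖) 0) := by
  refine ⟨?_, fun x hx => max_eq_right (by linarith)⟩
  refine LipschitzWith.max_const ?_ 0
  refine LipschitzWith.of_le_add fun x y => ?_
  have := norm_sub_norm_le y x
  rw [dist_comm, dist_eq_norm]
  linarith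

lemma FK_set_eq : {d : ℝ | ∃ f : EuclideanSpace ℝ (Fin n) → ℝ, Continuous f ∧ LipschitzWith 1 f ∧
    HasCompactSupport f ∧ tsupport f ⊆ closedBall 0 r ∧ d = |(∫ x, f x ∂μ) - ∫ x, f x ∂ν|} =
    {d : ℝ | ∃ f, IsTest r f ∧ d = |(∫ x, f x ∂μ) - ∫ x, f x ∂ν|} := by
  ext d
  constructor
  · rintro ⟨f, -, h2, -, h4, rfl⟩
    refine ⟨f, ⟨h2, fun x hx => ?_⟩, rfl⟩
    by_contra h
    have := h4 (subset_tsupport f h)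
    rw [mem_closedBall_zero_iff] at this
    linarith
  · rintro ⟨f, hf, rfl⟩
    exact ⟨f, hf.continuous, hf.1, hf.hasCompactSupport, hf.tsupport_subset, rfl⟩

lemma Fr_eq (r : ℝ) (μ ν : Measure (EuclideanSpace ℝ (Fin n))) :
    Fr r μ ν = sSup {d : ℝ | ∃ f, IsTest r f ∧ d = |(∫ x, f x ∂μ) - ∫ x, f x ∂ν|} := by
  rw [Fr, FK, FK_set_eq]

lemma Fr_le {a : ℝ} (h : ∀ f, IsTest r f → |(∫ x, f x ∂μ) - ∫ x, f x ∂ν| ≤ a) :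
    Fr r μ ν ≤ a := by
  rw [Fr_eq]
  refine csSup_le ⟨_, _, isTest_zero, rfl⟩ ?_
  rintro d ⟨f, hf, rfl⟩
  exact h f hf

lemma Fr_nonneg : 0 ≤ Fr r μ ν := by
  rw [Fr_eq]
  refine Real.sSup_nonneg ?_
  rintro d ⟨f, -, rfl⟩
  exact abs_nonneg _

lemma Fb_nonneg : 0 ≤ Fb r μ := Fr_nonneg

lemma Fr_self : Fr r μ μ = 0 :=
  le_antisymm (Fr_le fun f _ => by simp) Fr_nonneg

lemma Fr_comm : Fr r μ ν = Fr r ν μ := by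
  simp_rw [Fr_eq, abs_sub_comm]

variable [NeZero n]

lemma IsTest.abs_le (hf : IsTest r f) (x : EuclideanSpace ℝ (Fin n)) : |f x| ≤ 2 * |r| + 1 := by
  by_cases hx : r < ‖x‖
  · rw [hf.2 x hx, abs_zero]; positivity
  obtain ⟨y, hy⟩ := exists_norm_eq (EuclideanSpace ℝ (Fin n)) (c := |r| + 1) (by positivity)
  have h1 := hf.1.dist_le_mul x y
  rw [hf.2 y (by rw [hy]; linarith [le_abs_self r]), Real.dist_eq, sub_zero, dist_eq_norm] at h1
  have := norm_sub_le x y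
  simp only [NNReal.coe_one, one_mul] at h1
  linarith [le_abs_self r]

lemma IsTest.abs_integral_le (hf : IsTest r f) [IsLocallyFiniteMeasure μ] :
    |∫ x, f x ∂μ| ≤ (2 * |r| + 1) * μ.real (closedBall 0 r) := by
  rw [← setIntegral_eq_integral_of_forall_compl_eq_zero (s := closedBall 0 r)]
  · exact norm_setIntegral_le_of_norm_le_const (isCompact_closedBall _ _).measure_lt_top
      fun x _ => (Real.norm_eq_abs (f x)).trans_le (hf.abs_le x)
  · intro x hx
    exact hf.2 x (by simpa using hx)

lemma abs_sub_le_Fr [IsLocallyFiniteMeasure μ] [IsLocallyFiniteMeasure ν] (hf : IsTest r f) :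
    |(∫ x, f x ∂μ) - ∫ x, f x ∂ν| ≤ Fr r μ ν := by
  rw [Fr_eq]
  refine le_csSup ⟨(2 * |r| + 1) * μ.real (closedBall 0 r)
    + (2 * |r| + 1) * ν.real (closedBall 0 r), ?_⟩ ⟨f, hf, rfl⟩
  rintro d ⟨g, hg, rfl⟩
  exact (abs_sub _ _).trans (add_le_add hg.abs_integral_le hg.abs_integral_le)

lemma abs_integral_le_Fb [IsLocallyFiniteMeasure μ] (hf : IsTest r f) :
    |∫ x, f x ∂μ| ≤ Fb r μ := by
  simpa [Fb] using abs_sub_le_Fr (μ := μ) (ν := 0) hf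

lemma Fr_triangle [IsLocallyFiniteMeasure μ] [IsLocallyFiniteMeasure ν] [IsLocallyFiniteMeasure ρ] :
    Fr r μ ρ ≤ Fr r μ ν + Fr r ν ρ :=
  Fr_le fun _ hf => (abs_sub_le _ _ _).trans (add_le_add (abs_sub_le_Fr hf) (abs_sub_le_Fr hf))

lemma abs_Fb_sub_Fb_le [IsLocallyFiniteMeasure μ] [IsLocallyFiniteMeasure ν] :
    |Fb r μ - Fb r ν| ≤ Fr r μ ν := by
  have h1 := Fr_triangle (r := r) (μ := μ) (ν := ν) (ρ := 0)
  have h2 := Fr_triangle (r := r) (μ := ν) (ν := μ) (ρ := 0)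
  rw [Fr_comm (μ := ν) (ν := μ)] at h2
  rw [abs_le, Fb, Fb]
  constructor <;> linarith

lemma Fr_mono [IsLocallyFiniteMeasure μ] [IsLocallyFiniteMeasure ν] (h : r ≤ s) :
    Fr r μ ν ≤ Fr s μ ν :=
  Fr_le fun _ hf => abs_sub_le_Fr (hf.mono h)

lemma Fb_mono [IsLocallyFiniteMeasure μ] (h : r ≤ s) : Fb r μ ≤ Fb s μ := Fr_mono h

end Distance

section Scaling

variable {n : ℕ} {r s c d : ℝ} {f : EuclideanSpace ℝ (Fin n) → ℝ}
  {μ ν ρ : Measure (EuclideanSpace ℝ (Fin n))}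

instance isLocallyFiniteMeasure_ofReal_smul [IsLocallyFiniteMeasure μ] :
    IsLocallyFiniteMeasure (ENNReal.ofReal c • μ) :=
  inferInstanceAs (IsLocallyFiniteMeasure (c.toNNReal • μ))

lemma integral_ofReal_smul (hc : 0 ≤ c) :
    ∫ x, f x ∂(ENNReal.ofReal c • μ) = c * ∫ x, f x ∂μ := by
  rw [integral_smul_measure, ENNReal.toReal_ofReal hc, smul_eq_mul]

lemma ofReal_smul_smul (hc : 0 ≤ c) :
    ENNReal.ofReal c • ENNReal.ofReal d • μ = ENNReal.ofReal (c * d) • μ := by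
  rw [smul_smul, ENNReal.ofReal_mul hc]

lemma Fr_smul (hc : 0 ≤ c) :
    Fr r (ENNReal.ofReal c • μ) (ENNReal.ofReal c • ν) = c * Fr r μ ν := by
  rw [Fr_eq, Fr_eq, ← smul_eq_mul c, ← Real.sSup_smul_of_nonneg hc]
  congr 1
  ext d
  simp only [integral_ofReal_smul hc, mem_ofPred_eq, Set.mem_smul_set, smul_eq_mul]
  constructor
  · rintro ⟨f, hf, rfl⟩
    exact ⟨_, ⟨f, hf, rfl⟩, by rw [← mul_sub, abs_mul, abs_of_nonneg hc]⟩
  · rintro ⟨_, ⟨f, hf, rfl⟩, rfl⟩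
    exact ⟨f, hf, by rw [← mul_sub, abs_mul, abs_of_nonneg hc]⟩

lemma Fb_smul (hc : 0 ≤ c) : Fb r (ENNReal.ofReal c • μ) = c * Fb r μ := by
  rw [Fb, Fb, ← Fr_smul hc, smul_zero]

lemma Fr_smul_smul_le [NeZero n] [IsLocallyFiniteMeasure μ] (hc : 0 ≤ c) (hd : 0 ≤ d) :
    Fr r (ENNReal.ofReal c • μ) (ENNReal.ofReal d • μ) ≤ |c - d| * Fb r μ := by
  refine Fr_le fun f hf => ?_
  rw [integral_ofReal_smul hc, integral_ofReal_smul hd, ← sub_mul, abs_mul]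
  exact mul_le_mul_of_nonneg_left (abs_integral_le_Fb hf) (abs_nonneg _)

lemma blowup_eq_map (hr : r ≠ 0) : blowup μ 0 r =
    Measure.map (Homeomorph.smulOfNeZero r⁻¹ (inv_ne_zero hr)) μ := by
  simp only [blowup, sub_zero]
  rfl

lemma isLocallyFiniteMeasure_blowup [IsLocallyFiniteMeasure μ] (hr : r ≠ 0) :
    IsLocallyFiniteMeasure (blowup μ 0 r) := by
  rw [blowup_eq_map hr]
  have := Measure.IsFiniteMeasureOnCompacts.map μ
    (Homeomorph.smulOfNeZero (α := EuclideanSpace ℝ (Fin n)) r⁻¹ (inv_ne_zero hr))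
  infer_instance

lemma integral_blowup (hr : r ≠ 0) : ∫ x, f x ∂(blowup μ 0 r) = ∫ x, f (r⁻¹ • x) ∂μ := by
  rw [blowup_eq_map hr, (Homeomorph.measurableEmbedding _).integral_map]
  rfl

lemma blowup_blowup : blowup (blowup μ 0 r) 0 s = blowup μ 0 (s * r) := by
  simp only [blowup, sub_zero]
  rw [Measure.map_map (by fun_prop) (by fun_prop)]
  congr 1
  ext1 x
  simp [smul_smul, mul_comm]

lemma blowup_one : blowup μ 0 1 = μ := by
  simp [blowup, Measure.map_id']

lemma blowup_smul : blowup (ENNReal.ofReal c • μ) 0 r = ENNReal.ofReal c • blowup μ 0 r := by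
  simp only [blowup, Measure.map_smul]

lemma blowup_zero : blowup (0 : Measure (EuclideanSpace ℝ (Fin n))) 0 r = 0 := by
  simp [blowup]

lemma IsTest.dilate (hr : 0 < r) (hf : IsTest s f) :
    IsTest (r * s) (fun x => r * f (r⁻¹ • x)) := by
  refine ⟨LipschitzWith.of_dist_le_mul fun x y => ?_, fun x hx => ?_⟩
  · have := hf.1.dist_le_mul (r⁻¹ • x) (r⁻¹ • y)
    rw [dist_smul₀, Real.dist_eq, NNReal.coe_one, one_mul, norm_inv, Real.norm_of_nonneg hr.le]
      at this
    rw [Real.dist_eq, ← mul_sub, abs_mul, abs_of_pos hr, NNReal.coe_one, one_mul]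
    calc r * |f (r⁻¹ • x) - f (r⁻¹ • y)| ≤ r * (r⁻¹ * dist x y) := by gcongr
      _ = dist x y := by field_simp
  · refine mul_eq_zero_of_right _ (hf.2 _ ?_)
    rw [norm_smul, norm_inv, Real.norm_of_nonneg hr.le, inv_mul_eq_div, lt_div_iff₀ hr]
    linarith

lemma mul_Fr_blowup_le [NeZero n] [IsLocallyFiniteMeasure μ] [IsLocallyFiniteMeasure ν]
    (hr : 0 < r) : r * Fr s (blowup μ 0 r) (blowup ν 0 r) ≤ Fr (r * s) μ ν := by
  rw [mul_comm, ← le_div_iff₀ hr]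
  refine Fr_le fun f hf => ?_
  rw [integral_blowup hr.ne', integral_blowup hr.ne', le_div_iff₀ hr]
  have := abs_sub_le_Fr (μ := μ) (ν := ν) (hf.dilate hr)
  rwa [integral_const_mul, integral_const_mul, ← mul_sub, abs_mul, abs_of_pos hr, mul_comm] at this

lemma mul_Fr_blowup [NeZero n] [IsLocallyFiniteMeasure μ] [IsLocallyFiniteMeasure ν]
    (hr : 0 < r) : r * Fr s (blowup μ 0 r) (blowup ν 0 r) = Fr (r * s) μ ν := by
  refine le_antisymm (mul_Fr_blowup_le hr) ?_
  have := isLocallyFiniteMeasure_blowup (μ := μ) hr.ne'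
  have := isLocallyFiniteMeasure_blowup (μ := ν) hr.ne'
  have h := mul_Fr_blowup_le (s := r * s) (μ := blowup μ 0 r) (ν := blowup ν 0 r) (inv_pos.2 hr)
  rw [blowup_blowup, blowup_blowup, inv_mul_cancel₀ hr.ne', blowup_one, blowup_one,
    inv_mul_cancel_left₀ hr.ne'] at h
  rwa [inv_mul_le_iff₀ hr] at h

lemma mul_Fb_blowup [NeZero n] [IsLocallyFiniteMeasure μ] (hr : 0 < r) :
    r * Fb s (blowup μ 0 r) = Fb (r * s) μ := by
  rw [Fb, Fb, ← mul_Fr_blowup hr, blowup_zero]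

end Scaling

section Vague

variable {n : ℕ} {ι : Type*} {l : Filter ι} {r s c : ℝ} {f : EuclideanSpace ℝ (Fin n) → ℝ}
  {μ ν : Measure (EuclideanSpace ℝ (Fin n))} {m : ι → Measure (EuclideanSpace ℝ (Fin n))}

/-- Weak-* convergence of measures along an arbitrary filter. -/
def VagueTendsto (l : Filter ι) (m : ι → Measure (EuclideanSpace ℝ (Fin n)))
    (ν : Measure (EuclideanSpace ℝ (Fin n))) : Prop :=
  ∀ f : EuclideanSpace ℝ (Fin n) → ℝ, Continuous f → HasCompactSupport f →
    Tendsto (fun i => ∫ x, f x ∂(m i)) l (𝓝 (∫ x, f x ∂ν))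

lemma VagueTendsto.smul {a : ι → ℝ} (h : VagueTendsto l m ν) (ha : ∀ i, 0 ≤ a i) (hc : 0 ≤ c)
    (hac : Tendsto a l (𝓝 c)) :
    VagueTendsto l (fun i => ENNReal.ofReal (a i) • m i) (ENNReal.ofReal c • ν) := by
  intro f hf hf'
  simp_rw [integral_ofReal_smul (ha _), integral_ofReal_smul hc]
  exact hac.mul (h f hf hf')

lemma VagueTendsto.blowup (h : VagueTendsto l m ν) (hr : r ≠ 0) :
    VagueTendsto l (fun i => blowup (m i) 0 r) (blowup ν 0 r) := by
  intro f hf hf'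
  simp_rw [integral_blowup hr]
  exact h _ (hf.comp (continuous_const_smul _))
    (hf'.comp_homeomorph (Homeomorph.smulOfNeZero r⁻¹ (inv_ne_zero hr)))

lemma eq_of_forall_integral_eq [IsLocallyFiniteMeasure μ] [IsLocallyFiniteMeasure ν]
    (h : ∀ f : EuclideanSpace ℝ (Fin n) → ℝ, Continuous f → HasCompactSupport f →
      ∫ x, f x ∂μ = ∫ x, f x ∂ν) : μ = ν :=
  Measure.ext_of_integral_eq_on_compactlySupported
    fun f => h f f.continuous f.hasCompactSupport

lemma VagueTendsto.unique [l.NeBot] [IsLocallyFiniteMeasure μ] [IsLocallyFiniteMeasure ν]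
    (h : VagueTendsto l m μ) (h' : VagueTendsto l m ν) : μ = ν :=
  eq_of_forall_integral_eq fun f hf hf' => tendsto_nhds_unique (h f hf hf') (h' f hf hf')

lemma isLocallyFiniteMeasure_blowup_coe [IsLocallyFiniteMeasure μ] (t : Ioi (0 : ℝ)) :
    IsLocallyFiniteMeasure (blowup μ 0 t) :=
  isLocallyFiniteMeasure_blowup t.2.ne'

/-- The dilations of a measure depend continuously on the dilation factor. -/
lemma vagueTendsto_blowup [IsLocallyFiniteMeasure μ] (r : Ioi (0 : ℝ)) :
    VagueTendsto (𝓝 r) (fun t : Ioi (0 : ℝ) => blowup μ 0 t) (blowup μ 0 r) := by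
  intro f hf hf'
  obtain ⟨R, hR⟩ := hf'.isCompact.isBounded.subset_closedBall 0
  have h : ContinuousOn (fun t : ℝ => ∫ x, f (t⁻¹ • x) ∂μ) (Ioo 0 ((r : ℝ) + 1)) := by
    refine continuousOn_integral_of_compact_support
      (isCompact_closedBall (0 : EuclideanSpace ℝ (Fin n)) ((r + 1) * |R|)) ?_ ?_
    · have h1 : ContinuousOn (fun q : ℝ × EuclideanSpace ℝ (Fin n) => q.1⁻¹)
          (Ioo 0 ((r : ℝ) + 1) ×ˢ univ) := continuousOn_fst.inv₀ fun q hq => hq.1.1.ne'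
      exact hf.comp_continuousOn (h1.smul continuousOn_snd)
    · intro t x ht hx
      by_contra h0
      have h1 := hR (subset_tsupport f h0)
      rw [mem_closedBall_zero_iff, norm_smul, norm_inv, Real.norm_of_nonneg ht.1.le,
        inv_mul_le_iff₀ ht.1] at h1
      refine hx (mem_closedBall_zero_iff.2 (h1.trans ?_))
      exact mul_le_mul ht.2.le (le_abs_self R) ((mul_nonneg_iff_of_pos_left ht.1).1
        ((norm_nonneg x).trans h1)) (add_pos r.2 one_pos).le
  simp_rw [fun t : Ioi (0 : ℝ) => integral_blowup (μ := μ) (f := f) t.2.ne']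
  exact (h.continuousAt (Ioo_mem_nhds r.2 (lt_add_one _))).tendsto.comp
    continuousAt_subtype_val.tendsto

/-- The test functions of a given radius form a totally bounded set for the uniform distance. -/
lemma exists_finite_net (n : ℕ) [NeZero n] (r : ℝ) {ε : ℝ} (hε : 0 < ε) :
    ∃ t : Set (EuclideanSpace ℝ (Fin n) → ℝ), t.Finite ∧ (∀ g ∈ t, IsTest r g) ∧
      ∀ f, IsTest r f → ∃ g ∈ t, ∀ x, |f x - g x| ≤ ε := by
  let K := closedBall (0 : EuclideanSpace ℝ (Fin n)) r
  have : CompactSpace K := isCompact_iff_compactSpace.1 (isCompact_closedBall 0 r)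
  let T := {f : EuclideanSpace ℝ (Fin n) → ℝ // IsTest r f}
  let Φ : T → BoundedContinuousFunction K ℝ := fun f =>
    BoundedContinuousFunction.mkOfCompact
      ⟨fun x => f.1 x, f.2.continuous.comp continuous_subtype_val⟩
  have hc : IsCompact (closure (range Φ)) := by
    refine BoundedContinuousFunction.arzela_ascoli (Icc (-(2 * |r| + 1)) (2 * |r| + 1))
      isCompact_Icc _ ?_ ?_
    · rintro _ x ⟨f, rfl⟩
      exact abs_le.1 (f.2.abs_le (x : EuclideanSpace ℝ (Fin n)))
    · refine (LipschitzWith.uniformEquicontinuous _ 1 ?_).equicontinuous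
      rintro ⟨_, f, rfl⟩
      exact f.2.1.comp (LipschitzWith.subtype_val _) |>.weaken (by simp)
  obtain ⟨t, ht, htf, hcov⟩ :=
    Metric.finite_approx_of_totallyBounded (hc.totallyBounded.subset subset_closure) ε hε
  have : Nonempty T := ⟨⟨_, isTest_zero⟩⟩
  have hmem : ∀ y ∈ t, ∃ g : T, Φ g = y := fun y hy => ht hy
  choose! u hu using hmem
  refine ⟨(fun y => (u y).1) '' t, htf.image _, ?_, fun f hf => ?_⟩
  · rintro _ ⟨y, -, rfl⟩
    exact (u y).2
  · obtain ⟨y, hy, hfy⟩ := mem_iUnion₂.1 (hcov (mem_range_self (⟨f, hf⟩ : T)))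
    refine ⟨_, mem_image_of_mem _ hy, fun x => ?_⟩
    by_cases hx : r < ‖x‖
    · simp [hf.2 x hx, (u y).2.2 x hx, hε.le]
    · rw [← hu y hy] at hfy
      have hxK : x ∈ K := mem_closedBall_zero_iff.2 (not_lt.1 hx)
      exact (BoundedContinuousFunction.dist_coe_le_dist (f := Φ ⟨f, hf⟩) (g := Φ (u y))
        ⟨x, hxK⟩).trans (mem_ball.1 hfy).le

lemma abs_integral_sub_le {g : EuclideanSpace ℝ (Fin n) → ℝ} {ε : ℝ} [IsLocallyFiniteMeasure μ]
    (hf : Integrable f μ) (hg : Integrable g μ)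
    (hf0 : ∀ x, r < ‖x‖ → f x = 0) (hg0 : ∀ x, r < ‖x‖ → g x = 0) (hε : 0 ≤ ε)
    (h : ∀ x, |f x - g x| ≤ ε) :
    |(∫ x, f x ∂μ) - ∫ x, g x ∂μ| ≤ ε * ∫ x, max (r + 1 - ‖x‖) 0 ∂μ := by
  have hi : Integrable (fun x : EuclideanSpace ℝ (Fin n) => ε * max (r + 1 - ‖x‖) 0) μ :=
    (isTest_cone (r + 1)).integrable.const_mul ε
  rw [← integral_sub hf hg, ← integral_const_mul]
  suffices h' : ‖∫ x, (f x - g x) ∂μ‖ ≤ ∫ x, ε * max (r + 1 - ‖x‖) 0 ∂μ from h'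
  refine norm_integral_le_of_norm_le hi (Eventually.of_forall fun x => ?_)
  by_cases hx : r < ‖x‖
  · rw [hf0 x hx, hg0 x hx, sub_zero, norm_zero]
    positivity
  · refine (h x).trans (le_mul_of_one_le_right hε (le_max_of_le_left ?_))
    linarith

variable [NeZero n]

/-- Weak-* convergence implies convergence with respect to `F_r`. -/
lemma VagueTendsto.tendsto_Fr [∀ i, IsLocallyFiniteMeasure (m i)] [IsLocallyFiniteMeasure ν]
    (h : VagueTendsto l m ν) (r : ℝ) : Tendsto (fun i => Fr r (m i) ν) l (𝓝 0) := by
  rw [Metric.tendsto_nhds]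
  intro δ hδ
  have hcone := isTest_cone (n := n) (r + 1)
  set A := ∫ x, max (r + 1 - ‖x‖) 0 ∂ν with hA
  have hA0 : 0 ≤ A := integral_nonneg fun x => le_max_right _ _
  obtain ⟨t, htf, ht, hnet⟩ := exists_finite_net n r (ε := δ / (4 * (A + 1))) (by positivity)
  have h1 : ∀ᶠ i in l, ∫ x, max (r + 1 - ‖x‖) 0 ∂(m i) < A + 1 :=
    (h _ hcone.continuous hcone.hasCompactSupport).eventually_lt_const (by linarith)
  have h2 : ∀ᶠ i in l, ∀ g ∈ t, |(∫ x, g x ∂(m i)) - ∫ x, g x ∂ν| < δ / 4 :=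
    (eventually_all_finite htf).2 fun g hg =>
      Metric.tendsto_nhds.1 (h g (ht g hg).continuous (ht g hg).hasCompactSupport) _ (by linarith)
  filter_upwards [h1, h2] with i hi1 hi2
  rw [Real.dist_eq, sub_zero, abs_of_nonneg Fr_nonneg]
  refine lt_of_le_of_lt (Fr_le (a := 3 * δ / 4) fun f hf => ?_) (by linarith)
  obtain ⟨g, hg, hfg⟩ := hnet f hf
  have hε : 0 ≤ δ / (4 * (A + 1)) := by positivity
  have e1 := abs_integral_sub_le (μ := m i) hf.integrable (ht g hg).integrable hf.2 (ht g hg).2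
    hε hfg
  have e2 := abs_integral_sub_le (μ := ν) hf.integrable (ht g hg).integrable hf.2 (ht g hg).2
    hε hfg
  have e3 : δ / (4 * (A + 1)) * (A + 1) = δ / 4 := by field_simp
  have e4 := mul_le_mul_of_nonneg_left hi1.le hε
  have e5 := mul_le_mul_of_nonneg_left (le_add_of_nonneg_right zero_le_one : A ≤ A + 1) hε
  have e6 := hi2 g hg
  rw [abs_le] at e1 e2 ⊢
  rw [abs_lt] at e6
  constructor <;> linarith [e1.1, e1.2, e2.1, e2.2, e6.1, e6.2]

lemma VagueTendsto.tendsto_Fb [∀ i, IsLocallyFiniteMeasure (m i)] [IsLocallyFiniteMeasure ν]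
    (h : VagueTendsto l m ν) (r : ℝ) : Tendsto (fun i => Fb r (m i)) l (𝓝 (Fb r ν)) := by
  rw [tendsto_iff_dist_tendsto_zero]
  exact squeeze_zero (fun _ => dist_nonneg) (fun i => abs_Fb_sub_Fb_le (μ := m i) (ν := ν))
    (h.tendsto_Fr r)

/-- Convergence with respect to all `F_r` implies weak-* convergence. -/
lemma vagueTendsto_of_tendsto_Fr [∀ i, IsLocallyFiniteMeasure (m i)] [IsLocallyFiniteMeasure ν]
    (h : ∀ r, Tendsto (fun i => Fr r (m i) ν) l (𝓝 0)) : VagueTendsto l m ν := by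
  intro f hf hf'
  obtain ⟨R, hR⟩ := hf'.isCompact.isBounded.subset_closedBall 0
  have hf0 : ∀ x, R < ‖x‖ → f x = 0 := fun x hx => by
    by_contra h0
    exact hx.not_ge (mem_closedBall_zero_iff.1 (hR (subset_tsupport f h0)))
  rw [Metric.tendsto_nhds]
  intro δ hδ
  set A := Fb (R + 1) ν with hA
  have hA0 : 0 ≤ A := Fb_nonneg
  have hε : 0 < δ / (4 * (A + 1)) := by positivity
  obtain ⟨g, hg, hgf, hgs⟩ := hf.exists_contDiff_approx 1 (ε := fun _ => δ / (4 * (A + 1)))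
    continuous_const (fun _ => hε)
  have hg0 : ∀ x, R < ‖x‖ → g x = 0 := fun x hx => by
    by_contra h0
    exact hgs h0 (hf0 x hx)
  have hg' : HasCompactSupport g := hf'.mono hgs
  obtain ⟨K, hK⟩ := ContDiff.lipschitzWith_of_hasCompactSupport hg' hg (by simp)
  have hK0 : (0 : ℝ) < K + 1 := by positivity
  have htest : IsTest R (fun x => ((K : ℝ) + 1)⁻¹ * g x) := by
    refine ⟨LipschitzWith.of_dist_le_mul fun x y => ?_, fun x hx => by simp [hg0 x hx]⟩
    have := hK.dist_le_mul x y
    rw [Real.dist_eq] at this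
    rw [Real.dist_eq, ← mul_sub, abs_mul, abs_of_pos (inv_pos.2 hK0), NNReal.coe_one, one_mul,
      inv_mul_le_iff₀ hK0]
    linarith [dist_nonneg (x := x) (y := y)]
  have h1 : ∀ᶠ i in l, Fr (R + 1) (m i) ν < 1 := (h _).eventually_lt_const one_pos
  have h2 : ∀ᶠ i in l, Fr R (m i) ν < δ / (4 * (K + 1)) :=
    (h _).eventually_lt_const (by positivity)
  filter_upwards [h1, h2] with i hi1 hi2
  have key : ∀ (ρ : Measure (EuclideanSpace ℝ (Fin n))) [IsLocallyFiniteMeasure ρ],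
      Fb (R + 1) ρ ≤ A + 1 → |(∫ x, f x ∂ρ) - ∫ x, g x ∂ρ| ≤ δ / 4 := by
    intro ρ _ hρ
    have e1 := abs_integral_sub_le (μ := ρ) (hf.integrable_of_hasCompactSupport hf')
      (hg.continuous.integrable_of_hasCompactSupport hg') hf0 hg0 hε.le
      (fun x => by rw [← Real.dist_eq, dist_comm]; exact (hgf x).le)
    have e2 := (le_abs_self _).trans (abs_integral_le_Fb (μ := ρ) (isTest_cone (R + 1)))
    have e3 : δ / (4 * (A + 1)) * (A + 1) = δ / 4 := by field_simp
    exact e1.trans (e3 ▸ mul_le_mul_of_nonneg_left (e2.trans hρ) hε.le)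
  have e1 := key ν (by linarith)
  have e2 := key (m i) (by
    linarith [(le_abs_self _).trans (abs_Fb_sub_Fb_le (r := R + 1) (μ := m i) (ν := ν))])
  have e3 := abs_sub_le_Fr (μ := m i) (ν := ν) htest
  rw [integral_const_mul, integral_const_mul, ← mul_sub, abs_mul, abs_of_pos (inv_pos.2 hK0),
    inv_mul_le_iff₀ hK0] at e3
  have e4 := mul_lt_mul_of_pos_left hi2 hK0
  have e5 : ((K : ℝ) + 1) * (δ / (4 * (K + 1))) = δ / 4 := by field_simp
  rw [Real.dist_eq, abs_lt]
  rw [abs_le] at e1 e2 e3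
  constructor <;> linarith [e1.1, e1.2, e2.1, e2.2, e3.1, e3.2]

lemma exists_Fb_pos [IsLocallyFiniteMeasure μ] (hμ : μ ≠ 0) : ∃ r, 0 < r ∧ 0 < Fb r μ := by
  by_contra! h
  refine hμ ?_
  have h0 : VagueTendsto (atTop : Filter ℕ) (fun _ => μ) 0 := by
    refine vagueTendsto_of_tendsto_Fr fun r => ?_
    have : Fr r μ 0 = 0 := by
      refine le_antisymm ?_ Fr_nonneg
      rcases lt_or_ge 0 r with hr | hr
      · exact h r hr
      · exact (Fb_mono (hr.trans zero_le_one)).trans (h 1 one_pos)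
    simp [this]
  exact VagueTendsto.unique (fun _ _ _ => tendsto_const_nhds) h0

open CompactlySupported in
/-- Bounded sequences of measures have weak-* cluster points along any ultrafilter. -/
lemma exists_vagueTendsto_ultrafilter (U : Ultrafilter ι) [∀ i, IsLocallyFiniteMeasure (m i)]
    (hb : ∀ r, ∃ B, ∀ᶠ i in (U : Filter ι), Fb r (m i) ≤ B) :
    ∃ η : Measure (EuclideanSpace ℝ (Fin n)), IsLocallyFiniteMeasure η ∧
      VagueTendsto (U : Filter ι) m η := by
  have hlim : ∀ f : C_c(EuclideanSpace ℝ (Fin n), ℝ),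
      ∃ a, Tendsto (fun i => ∫ x, f x ∂(m i)) (U : Filter ι) (𝓝 a) := by
    intro f
    obtain ⟨R, hR⟩ := f.hasCompactSupport.isCompact.isBounded.subset_closedBall 0
    have hf0 : ∀ x, R < ‖x‖ → f x = 0 := fun x hx => by
      by_contra h0
      exact hx.not_ge (mem_closedBall_zero_iff.1 (hR (subset_tsupport f h0)))
    obtain ⟨C, hC⟩ := f.hasCompactSupport.exists_bound_of_continuous f.continuous
    have hC0 : 0 ≤ C := (norm_nonneg _).trans (hC 0)
    obtain ⟨B, hB⟩ := hb (R + 1)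
    have hmem : ∀ᶠ i in (U : Filter ι), ∫ x, f x ∂(m i) ∈ Icc (-(C * B)) (C * B) := by
      filter_upwards [hB] with i hi
      have e1 := abs_integral_sub_le (μ := m i) (g := fun _ => 0)
        (f.continuous.integrable_of_hasCompactSupport f.hasCompactSupport)
        (integrable_zero _ _ _) hf0 (fun _ _ => rfl) hC0 (fun x => by simpa using hC x)
      have e2 := (le_abs_self _).trans (abs_integral_le_Fb (μ := m i) (isTest_cone (R + 1)))
      rw [integral_zero, sub_zero] at e1
      exact abs_le.1 (e1.trans (mul_le_mul_of_nonneg_left (e2.trans hi) hC0))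
    obtain ⟨a, -, ha⟩ := isCompact_Icc.ultrafilter_le_nhds (U.map fun i => ∫ x, f x ∂(m i))
      (le_principal_iff.2 hmem)
    exact ⟨a, ha⟩
  choose L hL using hlim
  have hint : ∀ (f : C_c(EuclideanSpace ℝ (Fin n), ℝ)) i, Integrable f (m i) := fun f i =>
    f.continuous.integrable_of_hasCompactSupport f.hasCompactSupport
  let Λ : C_c(EuclideanSpace ℝ (Fin n), ℝ) →ₚ[ℝ] ℝ := PositiveLinearMap.mk₀
    { toFun := L
      map_add' := fun f g => tendsto_nhds_unique (hL (f + g)) <| by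
        refine ((hL f).add (hL g)).congr fun i => ?_
        rw [← integral_add (hint f i) (hint g i)]
        rfl
      map_smul' := fun c f => tendsto_nhds_unique (hL (c • f)) <| by
        refine ((hL f).const_mul c).congr fun i => ?_
        rw [← integral_const_mul]
        rfl }
    (fun f hf => ge_of_tendsto' (hL f) fun i => integral_nonneg hf)
  refine ⟨RealRMK.rieszMeasure Λ, inferInstance, fun f hf hf' => ?_⟩
  have := RealRMK.integral_rieszMeasure Λ ⟨⟨f, hf⟩, hf'⟩
  have h2 : Λ ⟨⟨f, hf⟩, hf'⟩ = L ⟨⟨f, hf⟩, hf'⟩ := rfl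
  rw [h2] at this
  have h3 := hL ⟨⟨f, hf⟩, hf'⟩
  rw [← this] at h3
  exact h3

/-- Sequences of measures which are bounded on every ball have weak-* convergent subsequences. -/
lemma exists_subseq_vagueTendsto {m : ℕ → Measure (EuclideanSpace ℝ (Fin n))}
    [∀ i, IsLocallyFiniteMeasure (m i)] (hb : ∀ r, ∃ B, ∀ᶠ i in atTop, Fb r (m i) ≤ B) :
    ∃ η : Measure (EuclideanSpace ℝ (Fin n)), IsLocallyFiniteMeasure η ∧
      ∃ φ : ℕ → ℕ, Tendsto φ atTop atTop ∧ VagueTendsto atTop (fun i => m (φ i)) η := by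
  have hU : (hyperfilter ℕ : Filter ℕ) ≤ atTop := Nat.hyperfilter_le_atTop
  obtain ⟨η, hη, h⟩ := exists_vagueTendsto_ultrafilter (m := m) (hyperfilter ℕ)
    fun r => (hb r).imp fun B hB => hU hB
  have hex : ∀ j : ℕ, ∃ i, j ≤ i ∧ Fr j (m i) η < 1 / ((j : ℝ) + 1) := fun j =>
    (((eventually_ge_atTop j).filter_mono hU).and
      ((h.tendsto_Fr j).eventually_lt_const Nat.one_div_pos_of_nat)).exists
  choose φ hφ1 hφ2 using hex
  refine ⟨η, hη, φ, tendsto_atTop_mono hφ1 tendsto_id, vagueTendsto_of_tendsto_Fr fun r => ?_⟩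
  refine squeeze_zero' (Eventually.of_forall fun _ => Fr_nonneg) ?_
    tendsto_one_div_add_atTop_nhds_zero_nat
  filter_upwards [eventually_ge_atTop ⌈r⌉₊] with j hj
  exact (Fr_mono (Nat.ceil_le.1 hj)).trans (hφ2 j).le

end Vague

section Cone

variable {n : ℕ} {r s c : ℝ} {μ ν : Measure (EuclideanSpace ℝ (Fin n))}
  {F : Set (Measure (EuclideanSpace ℝ (Fin n)))}

/-- The normalization of a measure with respect to `F_1`. -/
noncomputable def normalize (ν : Measure (EuclideanSpace ℝ (Fin n))) :
    Measure (EuclideanSpace ℝ (Fin n)) :=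
  ENNReal.ofReal (Fb 1 ν)⁻¹ • ν

instance [IsLocallyFiniteMeasure ν] : IsLocallyFiniteMeasure (normalize ν) :=
  isLocallyFiniteMeasure_ofReal_smul

lemma Fb_normalize : Fb r (normalize ν) = (Fb 1 ν)⁻¹ * Fb r ν :=
  Fb_smul (inv_nonneg.2 Fb_nonneg)

lemma Fb_one_normalize (h : 0 < Fb 1 ν) : Fb 1 (normalize ν) = 1 := by
  rw [Fb_normalize, inv_mul_cancel₀ h.ne']

lemma smul_normalize (h : 0 < Fb 1 ν) : ENNReal.ofReal (Fb 1 ν) • normalize ν = ν := by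
  rw [normalize, ofReal_smul_smul h.le, mul_inv_cancel₀ h.ne', ENNReal.ofReal_one, one_smul]

lemma VagueTendsto.normalize [NeZero n] {ι : Type*} {l : Filter ι}
    {m : ι → Measure (EuclideanSpace ℝ (Fin n))} [∀ i, IsLocallyFiniteMeasure (m i)]
    [IsLocallyFiniteMeasure ν] (h : VagueTendsto l m ν) (hν : 0 < Fb 1 ν) :
    VagueTendsto l (fun i => normalize (m i)) (normalize ν) :=
  h.smul (fun _ => inv_nonneg.2 Fb_nonneg) (inv_nonneg.2 hν.le) ((h.tendsto_Fb 1).inv₀ hν.ne')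

lemma dCone_nonneg : 0 ≤ dCone s ν F := by
  rw [dCone]
  split_ifs
  · exact zero_le_one
  · refine Real.sInf_nonneg ?_
    rintro d ⟨μ, -, -, rfl⟩
    exact Fr_nonneg

lemma dCone_eq_sInf (h : 0 < Fb s ν) : dCone s ν F =
    sInf {d : ℝ | ∃ μ ∈ F, Fb s μ = 1 ∧ d = Fr s (ENNReal.ofReal (Fb s ν)⁻¹ • ν) μ} := by
  rw [dCone, if_neg h.ne', ENNReal.ofReal_inv_of_pos h]

lemma dCone_le (h : 0 < Fb s ν) (hμ : μ ∈ F) (hμ1 : Fb s μ = 1) :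
    dCone s ν F ≤ Fr s (ENNReal.ofReal (Fb s ν)⁻¹ • ν) μ := by
  rw [dCone_eq_sInf h]
  refine csInf_le ⟨0, ?_⟩ ⟨μ, hμ, hμ1, rfl⟩
  rintro d ⟨μ, -, -, rfl⟩
  exact Fr_nonneg

lemma exists_of_dCone_lt {a : ℝ} (h : 0 < Fb s ν) (hF : ∃ μ ∈ F, Fb s μ = 1)
    (ha : dCone s ν F < a) :
    ∃ μ ∈ F, Fb s μ = 1 ∧ Fr s (ENNReal.ofReal (Fb s ν)⁻¹ • ν) μ < a := by
  rw [dCone_eq_sInf h] at ha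
  have hne : {d : ℝ | ∃ μ ∈ F, Fb s μ = 1 ∧
      d = Fr s (ENNReal.ofReal (Fb s ν)⁻¹ • ν) μ}.Nonempty :=
    hF.elim fun μ hμ => ⟨_, μ, hμ.1, hμ.2, rfl⟩
  obtain ⟨_, ⟨μ, hμ, hμ1, rfl⟩, h2⟩ := exists_lt_of_csInf_lt hne ha
  exact ⟨μ, hμ, hμ1, h2⟩

lemma dCone_smul (hc : 0 < c) : dCone s (ENNReal.ofReal c • ν) F = dCone s ν F := by
  rcases (Fb_nonneg (r := s) (μ := ν)).eq_or_lt with h | h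
  · rw [dCone, dCone, Fb_smul hc.le, ← h, mul_zero, if_pos rfl, if_pos rfl]
  · have h' : 0 < Fb s (ENNReal.ofReal c • ν) := by rw [Fb_smul hc.le]; positivity
    rw [dCone_eq_sInf h, dCone_eq_sInf h', Fb_smul hc.le, ofReal_smul_smul (by positivity)]
    have : (c * Fb s ν)⁻¹ * c = (Fb s ν)⁻¹ := by field_simp
    rw [this]

lemma isLocallyFiniteMeasure_of_mem (hF : IsDCone F) (hμ : μ ∈ F) : IsLocallyFiniteMeasure μ :=
  (hF.1 μ hμ).2

lemma normalize_mem_coneBasis (hF : IsDCone F) (hμ : μ ∈ F) (h : 0 < Fb 1 μ) :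
    normalize μ ∈ coneBasis F :=
  ⟨hF.2.1 μ hμ _ (inv_pos.2 h), Fb_one_normalize h⟩

variable [NeZero n]

/-- The distances to a d-cone at different scales are related by dilations. -/
lemma dCone_eq_dCone_blowup (hF : IsDCone F) [IsLocallyFiniteMeasure ν] (hs : 0 < s) :
    dCone s ν F = dCone 1 (blowup ν 0 s) F := by
  have hb := mul_Fb_blowup (μ := ν) (s := 1) hs
  rw [mul_one] at hb
  rcases (Fb_nonneg (r := 1) (μ := blowup ν 0 s)).eq_or_lt with h | h
  · rw [dCone, dCone, ← hb, ← h, mul_zero, if_pos rfl, if_pos rfl]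
  have h' : 0 < Fb s ν := by rw [← hb]; positivity
  have key : ∀ (m : Measure (EuclideanSpace ℝ (Fin n))) [IsLocallyFiniteMeasure m],
      Fr s (ENNReal.ofReal (Fb s ν)⁻¹ • ν) m =
        Fr 1 (ENNReal.ofReal (Fb 1 (blowup ν 0 s))⁻¹ • blowup ν 0 s)
          (ENNReal.ofReal s • blowup m 0 s) := by
    intro m _
    have e : (Fb 1 (blowup ν 0 s))⁻¹ = s * (Fb s ν)⁻¹ := by
      rw [← hb]
      field_simp
    rw [e, ← ofReal_smul_smul hs.le, Fr_smul hs.le, ← blowup_smul, mul_Fr_blowup hs, mul_one]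
  rw [dCone_eq_sInf h, dCone_eq_sInf h']
  congr 1
  ext d
  constructor
  · rintro ⟨m, hm, hm1, rfl⟩
    have := isLocallyFiniteMeasure_of_mem hF hm
    refine ⟨_, hF.2.1 _ (hF.2.2 m hm s hs) s hs, ?_, key m⟩
    rw [Fb_smul hs.le, mul_Fb_blowup hs, mul_one, hm1]
  · rintro ⟨m, hm, hm1, rfl⟩
    have hs' := inv_pos.2 hs
    have hmem := hF.2.1 _ (hF.2.2 m hm s⁻¹ hs') s⁻¹ hs'
    have := isLocallyFiniteMeasure_of_mem hF hmem
    have := isLocallyFiniteMeasure_of_mem hF hm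
    refine ⟨_, hmem, ?_, ?_⟩
    · have := mul_Fb_blowup (μ := m) (s := s) hs'
      rw [Fb_smul hs'.le, this, inv_mul_cancel₀ hs.ne', hm1]
    · rw [key, blowup_smul, blowup_blowup, ofReal_smul_smul hs.le, mul_inv_cancel₀ hs.ne',
        blowup_one, ENNReal.ofReal_one, one_smul]

lemma exists_Fb_le_of_mem_coneBasis (hF : IsDCone F) (hc : HasCompactBasis F) (A : ℝ) :
    ∃ C, ∀ μ ∈ coneBasis F, Fb A μ ≤ C := by
  by_contra! h
  choose m hm hmA using fun k : ℕ => h k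
  obtain ⟨ν, hν, φ, hφ, hlim⟩ := hc m hm
  have := isLocallyFiniteMeasure_of_mem hF hν.1
  have := fun k => isLocallyFiniteMeasure_of_mem hF (hm k).1
  have h1 := VagueTendsto.tendsto_Fb (l := atTop) hlim A
  refine not_tendsto_nhds_of_tendsto_atTop ?_ _ h1
  exact tendsto_atTop_mono (fun k => (hmA (φ k)).le)
    (tendsto_natCast_atTop_atTop.comp hφ.tendsto_atTop)

lemma Fb_mul_le (hF : IsDCone F) {A C : ℝ} (hC : ∀ μ ∈ coneBasis F, Fb A μ ≤ C) (hμ : μ ∈ F)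
    (hs : 0 < s) (h : 0 < Fb s μ) : Fb (s * A) μ ≤ C * Fb s μ := by
  have := isLocallyFiniteMeasure_of_mem hF hμ
  have hb := mul_Fb_blowup (μ := μ) (s := 1) hs
  rw [mul_one] at hb
  have h1 : 0 < Fb 1 (blowup μ 0 s) := by
    rw [← hb] at h
    exact (pos_iff_pos_of_mul_pos h).1 hs
  have h2 := hC _ (normalize_mem_coneBasis hF (hF.2.2 μ hμ s hs) h1)
  rw [Fb_normalize, inv_mul_le_iff₀ h1] at h2
  rw [← hb, ← mul_Fb_blowup hs]
  nlinarith

lemma continuousOn_Fb [IsLocallyFiniteMeasure μ] : ContinuousOn (fun t => Fb t μ) (Ioi 0) := by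
  rw [continuousOn_iff_continuous_domRestrict, continuous_iff_continuousAt]
  intro r
  have := isLocallyFiniteMeasure_blowup_coe (μ := μ)
  have h := (vagueTendsto_blowup (μ := μ) r).tendsto_Fb 1
  refine (continuousAt_subtype_val.tendsto.mul h).congr' ?_ |>.trans_eq ?_
  · exact Eventually.of_forall fun t => by simp [mul_Fb_blowup t.2]
  · simp [mul_Fb_blowup r.2]

/-- Every element of a d-cone with compact basis has the origin in its support. -/
lemma Fb_pos_of_mem (hF : IsDCone F) (hc : HasCompactBasis F) (hμ : μ ∈ F) (hs : 0 < s) :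
    0 < Fb s μ := by
  have := isLocallyFiniteMeasure_of_mem hF hμ
  by_contra! h0
  obtain ⟨C, hC⟩ := exists_Fb_le_of_mem_coneBasis hF hc 2
  obtain ⟨r, hr, hrμ⟩ := exists_Fb_pos (hF.1 μ hμ).1
  let S := {t : ℝ | 0 < t ∧ 0 < Fb t μ}
  have hne : S.Nonempty := ⟨r, hr, hrμ⟩
  have hsS : ∀ t ∈ S, s ≤ t := fun t ht => by
    by_contra! h
    exact absurd ht.2 ((Fb_mono h.le).trans h0).not_gt
  have hbdd : BddBelow S := ⟨s, hsS⟩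
  set σ := sInf S with hσdef
  have hσ : 0 < σ := hs.trans_le (le_csInf hne hsS)
  have hcont : ContinuousAt (fun t => Fb t μ) σ := continuousOn_Fb.continuousAt (Ioi_mem_nhds hσ)
  have hzero : Fb σ μ ≤ 0 := by
    by_contra! h
    have h1 : ∀ᶠ t in 𝓝[<] σ, 0 < t ∧ 0 < Fb t μ :=
      ((lt_mem_nhds hσ).and (hcont.eventually_const_lt h)).filter_mono nhdsWithin_le_nhds
    obtain ⟨t, ht, htσ⟩ := (h1.and self_mem_nhdsWithin).exists
    exact (csInf_le hbdd ht).not_gt htσ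
  have hle : Fb (2 * σ) μ ≤ C * Fb σ μ := by
    have hcl : σ ∈ closure S := csInf_mem_closure hne hbdd
    have : (𝓝[S] σ).NeBot := mem_closure_iff_nhdsWithin_neBot.1 hcl
    refine ge_of_tendsto ((hcont.tendsto.mono_left (nhdsWithin_le_nhds (s := S))).const_mul C) ?_
    filter_upwards [self_mem_nhdsWithin] with t ht
    refine (Fb_mono ?_).trans (Fb_mul_le hF hC hμ ht.1 ht.2)
    linarith [csInf_le hbdd ht]
  obtain ⟨t, ht, htσ⟩ := exists_lt_of_csInf_lt hne (show sInf S < 2 * σ by linarith)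
  have h1 := Fb_mono (μ := μ) htσ.le
  have h2 : Fb σ μ = 0 := le_antisymm hzero Fb_nonneg
  rw [h2, mul_zero] at hle
  linarith [ht.2]

lemma exists_mem_Fb_eq_one (hF : IsDCone F) (hc : HasCompactBasis F) (hne : F.Nonempty)
    (hs : 0 < s) : ∃ μ ∈ F, Fb s μ = 1 := by
  obtain ⟨μ, hμ⟩ := hne
  have h := Fb_pos_of_mem hF hc hμ hs
  exact ⟨_, hF.2.1 μ hμ _ (inv_pos.2 h), by rw [Fb_smul (inv_pos.2 h).le, inv_mul_cancel₀ h.ne']⟩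

/-- The elements of a compact basis are uniformly bounded from below on smaller balls. -/
lemma exists_one_le_mul_Fb (hF : IsDCone F) (hc : HasCompactBasis F) {A : ℝ} (hA : 0 < A) :
    ∃ C, 0 < C ∧ ∀ μ ∈ coneBasis F, ∀ s, A⁻¹ ≤ s → 1 ≤ C * Fb s μ := by
  obtain ⟨C, hC⟩ := exists_Fb_le_of_mem_coneBasis hF hc A
  refine ⟨max C 1, by positivity, fun μ hμ s hs => ?_⟩
  have := isLocallyFiniteMeasure_of_mem hF hμ.1
  have hs0 : 0 < s := (inv_pos.2 hA).trans_le hs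
  have h1 := Fb_mul_le hF hC hμ.1 hs0 (Fb_pos_of_mem hF hc hμ.1 hs0)
  calc 1 = Fb 1 μ := hμ.2.symm
    _ ≤ Fb (s * A) μ := Fb_mono ((inv_le_iff_one_le_mul₀ hA).1 hs)
    _ ≤ C * Fb s μ := h1
    _ ≤ max C 1 * Fb s μ := mul_le_mul_of_nonneg_right (le_max_left _ _) Fb_nonneg

end Cone

section ConeDistance

variable {n : ℕ} [NeZero n] {s : ℝ} {μ ν : Measure (EuclideanSpace ℝ (Fin n))}
  {F : Set (Measure (EuclideanSpace ℝ (Fin n)))}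

lemma dCone_one_eq_zero_of_mem (hF : IsDCone F) (hc : HasCompactBasis F) (hμ : μ ∈ F) :
    dCone 1 μ F = 0 := by
  have h := Fb_pos_of_mem hF hc hμ one_pos
  have h1 := normalize_mem_coneBasis hF hμ h
  refine le_antisymm ((dCone_le h h1.1 h1.2).trans_eq ?_) dCone_nonneg
  exact Fr_self

lemma dCone_one_le_add [IsLocallyFiniteMeasure μ] [IsLocallyFiniteMeasure ν] (hF : IsDCone F)
    (hex : ∃ m ∈ F, Fb 1 m = 1) (hμ : 0 < Fb 1 μ) (hν : 0 < Fb 1 ν) :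
    dCone 1 μ F ≤ dCone 1 ν F + Fr 1 (normalize μ) (normalize ν) := by
  refine le_of_forall_pos_le_add fun ε hε => ?_
  obtain ⟨m, hm, hm1, hlt⟩ := exists_of_dCone_lt hν hex (lt_add_of_pos_right _ hε)
  have := isLocallyFiniteMeasure_of_mem hF hm
  have h1 := Fr_triangle (r := 1) (μ := normalize μ) (ν := normalize ν) (ρ := m)
  have h2 : Fr 1 (normalize ν) m < dCone 1 ν F + ε := hlt
  have h3 : dCone 1 μ F ≤ Fr 1 (normalize μ) m := dCone_le hμ hm hm1
  linarith

lemma VagueTendsto.tendsto_dCone {ι : Type*} {l : Filter ι}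
    {m : ι → Measure (EuclideanSpace ℝ (Fin n))} [∀ i, IsLocallyFiniteMeasure (m i)]
    [IsLocallyFiniteMeasure ν] (h : VagueTendsto l m ν) (hF : IsDCone F)
    (hex : ∃ m ∈ F, Fb 1 m = 1) (hν : 0 < Fb 1 ν) :
    Tendsto (fun i => dCone 1 (m i) F) l (𝓝 (dCone 1 ν F)) := by
  rw [tendsto_iff_dist_tendsto_zero]
  refine squeeze_zero' (Eventually.of_forall fun _ => dist_nonneg) ?_
    ((h.normalize hν).tendsto_Fr 1)
  filter_upwards [(h.tendsto_Fb 1).eventually_const_lt hν] with i hi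
  have h1 := dCone_one_le_add hF hex hi hν
  have h2 := dCone_one_le_add hF hex hν hi
  rw [Fr_comm] at h2
  rw [Real.dist_eq, abs_le]
  constructor <;> linarith

/-- Closeness to a d-cone with compact basis at scale `1` is inherited by comparable smaller
scales. -/
lemma exists_dCone_le_mul_dCone_one (hF : IsDCone F) (hc : HasCompactBasis F) (hne : F.Nonempty)
    {A : ℝ} (hA : 0 < A) :
    ∃ C, 0 < C ∧ ∀ (ν : Measure (EuclideanSpace ℝ (Fin n))) [IsLocallyFiniteMeasure ν],
      ∀ s, A⁻¹ ≤ s → s ≤ 1 → 0 < Fb s ν → dCone s ν F ≤ C * dCone 1 ν F := by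
  obtain ⟨C, hC, hCm⟩ := exists_one_le_mul_Fb hF hc hA
  refine ⟨2 * C, by positivity, fun ν _ s hAs hs hν => ?_⟩
  have hs0 : 0 < s := (inv_pos.2 hA).trans_le hAs
  have hν1 : 0 < Fb 1 ν := hν.trans_le (Fb_mono hs)
  refine le_of_forall_pos_le_add fun ε hε => ?_
  obtain ⟨m, hm, hm1, hlt⟩ := exists_of_dCone_lt hν1 (exists_mem_Fb_eq_one hF hc hne one_pos)
    (lt_add_of_pos_right (dCone 1 ν F) (show 0 < ε / (2 * C) by positivity))
  have := isLocallyFiniteMeasure_of_mem hF hm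
  set N := normalize ν with hN
  set δ := dCone 1 ν F + ε / (2 * C) with hδ
  have ha : 0 < Fb s N := by rw [hN, Fb_normalize]; positivity
  have hb : 0 < Fb s m := Fb_pos_of_mem hF hc hm hs0
  have hbC : (Fb s m)⁻¹ ≤ C := (inv_le_iff_one_le_mul₀ hb).2 (hCm m ⟨hm, hm1⟩ s hAs)
  have hNm : Fr s N m ≤ δ := (Fr_mono hs).trans hlt.le
  have h1 : dCone s ν F = dCone s N F := (dCone_smul (inv_pos.2 hν1)).symm
  have h2 : dCone s N F ≤ Fr s (ENNReal.ofReal (Fb s N)⁻¹ • N) (ENNReal.ofReal (Fb s m)⁻¹ • m) :=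
    dCone_le ha (hF.2.1 m hm _ (inv_pos.2 hb))
      (by rw [Fb_smul (inv_pos.2 hb).le, inv_mul_cancel₀ hb.ne'])
  have h3 := Fr_triangle (r := s) (μ := ENNReal.ofReal (Fb s N)⁻¹ • N)
    (ν := ENNReal.ofReal (Fb s m)⁻¹ • N) (ρ := ENNReal.ofReal (Fb s m)⁻¹ • m)
  rw [Fr_smul (inv_pos.2 hb).le] at h3
  have h4 := Fr_smul_smul_le (r := s) (μ := N) (inv_pos.2 ha).le (inv_pos.2 hb).le
  have h5 : |(Fb s N)⁻¹ - (Fb s m)⁻¹| * Fb s N = (Fb s m)⁻¹ * |Fb s N - Fb s m| := by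
    rw [inv_sub_inv ha.ne' hb.ne', abs_div, abs_of_pos (mul_pos ha hb), abs_sub_comm]
    field_simp
  have h6 : (Fb s m)⁻¹ * |Fb s N - Fb s m| ≤ C * δ :=
    mul_le_mul hbC (abs_Fb_sub_Fb_le.trans hNm) (abs_nonneg _) hC.le
  have h7 : (Fb s m)⁻¹ * Fr s N m ≤ C * δ := mul_le_mul hbC hNm Fr_nonneg hC.le
  have h8 : 2 * C * δ = 2 * C * dCone 1 ν F + ε := by rw [hδ]; field_simp
  linarith

/-- Measures close to a d-cone with compact basis satisfy a doubling condition. -/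
lemma exists_Fb_one_le_mul_Fb_half (hF : IsDCone F) (hc : HasCompactBasis F) (hne : F.Nonempty) :
    ∃ C, 0 < C ∧ ∀ (ν : Measure (EuclideanSpace ℝ (Fin n))) [IsLocallyFiniteMeasure ν],
      0 < Fb 1 ν → dCone 1 ν F < C⁻¹ → Fb 1 ν ≤ C * Fb 2⁻¹ ν := by
  obtain ⟨C, hC, hCm⟩ := exists_one_le_mul_Fb hF hc two_pos
  refine ⟨2 * C, by positivity, fun ν _ hν hlt => ?_⟩
  obtain ⟨m, hm, hm1, hlt'⟩ :=
    exists_of_dCone_lt hν (exists_mem_Fb_eq_one hF hc hne one_pos) hlt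
  have := isLocallyFiniteMeasure_of_mem hF hm
  have h1 := hCm m ⟨hm, hm1⟩ _ le_rfl
  have h2 : Fr 2⁻¹ (normalize ν) m < (2 * C)⁻¹ :=
    (Fr_mono (by norm_num)).trans_lt hlt'
  have h3 := (abs_le.1 (abs_Fb_sub_Fb_le (r := 2⁻¹) (μ := normalize ν) (ν := m))).1
  rw [Fb_normalize] at h3
  have h4 : C * Fb 2⁻¹ m ≤ C * ((Fb 1 ν)⁻¹ * Fb 2⁻¹ ν + (2 * C)⁻¹) :=
    mul_le_mul_of_nonneg_left (by linarith) hC.le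
  have h5 : C * ((Fb 1 ν)⁻¹ * Fb 2⁻¹ ν + (2 * C)⁻¹) = C * Fb 2⁻¹ ν / Fb 1 ν + 1 / 2 := by
    field_simp
  have h6 : 1 / 2 ≤ C * Fb 2⁻¹ ν / Fb 1 ν := by linarith
  rw [le_div_iff₀ hν] at h6
  linarith

/-- A measure at distance zero from a d-cone with compact basis at all scales belongs to it. -/
lemma mem_of_forall_dCone_eq_zero (hF : IsDCone F) (hc : HasCompactBasis F) (hne : F.Nonempty)
    [IsLocallyFiniteMeasure ν] (hν : ν ≠ 0) (h : ∀ s, 0 < s → 0 < Fb s ν → dCone s ν F = 0) :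
    ν ∈ F := by
  obtain ⟨r, hr, hrν⟩ := exists_Fb_pos hν
  have hs : ∀ j : ℕ, 0 < r + j := fun j => by positivity
  have hb : ∀ j : ℕ, 0 < Fb (r + j) ν := fun j =>
    hrν.trans_le (Fb_mono (le_add_of_nonneg_right j.cast_nonneg))
  have hex : ∀ j : ℕ, ∃ a ∈ F, Fr (r + j) ν a < 1 / ((j : ℝ) + 1) := by
    intro j
    have hpos : 0 < (Fb (r + j) ν)⁻¹ * (1 / ((j : ℝ) + 1)) :=
      mul_pos (inv_pos.2 (hb j)) Nat.one_div_pos_of_nat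
    obtain ⟨m, hm, -, hlt⟩ := exists_of_dCone_lt (hb j) (exists_mem_Fb_eq_one hF hc hne (hs j))
      ((h _ (hs j) (hb j)).trans_lt hpos)
    refine ⟨_, hF.2.1 m hm _ (hb j), ?_⟩
    have e : ν = ENNReal.ofReal (Fb (r + j) ν) • ENNReal.ofReal (Fb (r + j) ν)⁻¹ • ν := by
      rw [ofReal_smul_smul (hb j).le, mul_inv_cancel₀ (hb j).ne', ENNReal.ofReal_one, one_smul]
    rw [lt_inv_mul_iff₀ (hb j), ← Fr_smul (hb j).le, ← e] at hlt
    exact hlt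
  choose a haF ha using hex
  have := fun j => isLocallyFiniteMeasure_of_mem hF (haF j)
  have hlim : VagueTendsto atTop a ν := by
    refine vagueTendsto_of_tendsto_Fr fun R => ?_
    refine squeeze_zero' (Eventually.of_forall fun _ => Fr_nonneg) ?_
      tendsto_one_div_add_atTop_nhds_zero_nat
    filter_upwards [eventually_ge_atTop ⌈R⌉₊] with j hj
    rw [Fr_comm]
    exact (Fr_mono (by linarith [Nat.ceil_le.1 hj])).trans (ha j).le
  have hpos : 0 < Fb 1 ν := by
    obtain ⟨C, hC⟩ := exists_Fb_le_of_mem_coneBasis hF hc r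
    have h1 : ∀ j, Fb r (a j) ≤ C * Fb 1 (a j) := fun j => by
      simpa using Fb_mul_le hF hC (haF j) one_pos (Fb_pos_of_mem hF hc (haF j) one_pos)
    have h2 := le_of_tendsto_of_tendsto' (hlim.tendsto_Fb r) ((hlim.tendsto_Fb 1).const_mul C) h1
    refine Fb_nonneg.lt_of_ne fun h0 => ?_
    rw [← h0, mul_zero] at h2
    exact h2.not_gt hrν
  obtain ⟨ν', hν', φ, hφ, hφlim⟩ := hc (fun j => normalize (a j)) fun j =>
    normalize_mem_coneBasis hF (haF j) (Fb_pos_of_mem hF hc (haF j) one_pos)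
  have := isLocallyFiniteMeasure_of_mem hF hν'.1
  have h1 : VagueTendsto atTop (fun k => normalize (a (φ k))) (normalize ν) := fun f hf hf' =>
    (hlim.normalize hpos f hf hf').comp hφ.tendsto_atTop
  have h2 : normalize ν = ν' := h1.unique hφlim
  rw [← smul_normalize hpos, h2]
  exact hF.2.1 _ hν'.1 _ hpos

end ConeDistance

section Crossing

/-- A continuous function on `(0, ∞)` that oscillates near the origin and is controlled under
bounded shrinking of its argument crosses a given level at arbitrarily small arguments in such a
way that it stays below this level on a long interval to the right. -/
lemma exists_last_crossing {g : ℝ → ℝ} {ε A C η : ℝ} (hg : ContinuousOn g (Ioi 0)) (hε : 0 < ε)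
    (h0 : ∀ a, 0 < a → ∀ η, 0 < η → ∃ r ∈ Ioo 0 η, g r < a)
    (h1 : ∀ η, 0 < η → ∃ s ∈ Ioo 0 η, ε < g s) (hA : 0 < A) (hC : 0 < C)
    (hgC : ∀ t, 0 < t → ∀ s, A⁻¹ ≤ s → s ≤ 1 → g (s * t) ≤ C * g t) (hη : 0 < η) :
    ∃ t ∈ Ioo 0 η, g t = ε ∧ ∀ t' ∈ Icc t (A * t), g t' ≤ ε := by
  obtain ⟨r, hr, hrε⟩ := h0 (min ε (ε / C)) (by positivity) η hη
  obtain ⟨s, hs, hsε⟩ := h1 r hr.1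
  rw [lt_min_iff, lt_div_iff₀' hC] at hrε
  have hcont : ContinuousOn g (Icc s r) := hg.mono fun x hx => hs.1.trans_le hx.1
  have hcomp : IsCompact (Icc s r ∩ g ⁻¹' Ici ε) :=
    isCompact_Icc.of_isClosed_subset
      (hcont.preimage_isClosed_of_isClosed isClosed_Icc isClosed_Ici) inter_subset_left
  obtain ⟨t, ⟨htI, htε⟩, hmax⟩ := hcomp.exists_isGreatest ⟨s, ⟨le_rfl, hs.2.le⟩, hsε.le⟩
  have ht0 : 0 < t := hs.1.trans_le htI.1
  obtain ⟨u, hu, hgu⟩ : ε ∈ g '' Icc t r :=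
    intermediate_value_Icc' htI.2 (hcont.mono (Icc_subset_Icc_left htI.1)) ⟨hrε.1.le, htε⟩
  have hut : u = t := le_antisymm (hmax ⟨⟨htI.1.trans hu.1, hu.2⟩, hgu.ge⟩) hu.1
  rw [hut] at hgu
  have hAt : A * t ≤ r := by
    by_contra! h
    have h2 := hgC r hr.1 (t / r)
      (by rw [inv_le_iff_one_le_mul₀' hA, ← mul_div_assoc, one_le_div hr.1]; exact h.le)
      (div_le_one_of_le₀ htI.2 hr.1.le)
    rw [div_mul_cancel₀ _ hr.1.ne', hgu] at h2
    linarith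
  refine ⟨t, ⟨ht0, htI.2.trans_lt hr.2⟩, hgu, fun t' ht' => ?_⟩
  by_contra! h
  have h2 : t' = t :=
    le_antisymm (hmax ⟨⟨htI.1.trans ht'.1, ht'.2.trans hAt⟩, h.le⟩) ht'.1
  rw [h2, hgu] at h
  exact h.false

end Crossing

section Tangents

variable {n : ℕ} {s t : ℝ} {μ ν ρ ω : Measure (EuclideanSpace ℝ (Fin n))}
  {F : Set (Measure (EuclideanSpace ℝ (Fin n)))}

/-- The tangent measures of `ρ` at the origin. -/
def tangents (ρ : Measure (EuclideanSpace ℝ (Fin n))) : Set (Measure (EuclideanSpace ℝ (Fin n))) :=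
  {ν | ν ≠ 0 ∧ IsLocallyFiniteMeasure ν ∧ ∃ c r : ℕ → ℝ,
    (∀ i, 0 < c i) ∧ (∀ i, 0 < r i) ∧ Tendsto r atTop (𝓝 0) ∧
    VagueTendsto atTop (fun i => ENNReal.ofReal (c i) • blowup ρ 0 (r i)) ν}

lemma blowupL_eq_blowup {Λ : EuclideanSpace ℝ (Fin n) →
      (EuclideanSpace ℝ (Fin n) ≃L[ℝ] EuclideanSpace ℝ (Fin n))}
    {p : EuclideanSpace ℝ (Fin n)} (r : ℝ) :
    blowupL Λ μ p r = blowup (blowupL Λ μ p 1) 0 r := by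
  simp only [blowup, blowupL, sub_zero, inv_one, one_smul]
  rw [Measure.map_map (by fun_prop) (by fun_prop)]
  congr 1
  ext1 x
  simp

lemma isLocallyFiniteMeasure_blowupL {Λ : EuclideanSpace ℝ (Fin n) →
      (EuclideanSpace ℝ (Fin n) ≃L[ℝ] EuclideanSpace ℝ (Fin n))}
    {p : EuclideanSpace ℝ (Fin n)} [IsLocallyFiniteMeasure μ] :
    IsLocallyFiniteMeasure (blowupL Λ μ p 1) := by
  have h : blowupL Λ μ p 1 =
      Measure.map ((Homeomorph.subRight p).trans (Λ p).symm.toHomeomorph) μ := by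
    simp only [blowupL, inv_one, one_smul]
    rfl
  rw [h]
  have := Measure.IsFiniteMeasureOnCompacts.map μ
    ((Homeomorph.subRight p).trans (Λ p).symm.toHomeomorph)
  infer_instance

lemma tanL_eq_tangents {Λ : EuclideanSpace ℝ (Fin n) →
      (EuclideanSpace ℝ (Fin n) ≃L[ℝ] EuclideanSpace ℝ (Fin n))}
    {p : EuclideanSpace ℝ (Fin n)} : TanL Λ μ p = tangents (blowupL Λ μ p 1) := by
  simp only [TanL, tangents, ← blowupL_eq_blowup]
  rfl

lemma blowup_mem_tangents (hν : ν ∈ tangents ρ) (hs : 0 < s) : blowup ν 0 s ∈ tangents ρ := by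
  obtain ⟨h0, hlf, c, r, hc, hr, hr0, hlim⟩ := hν
  refine ⟨fun h => h0 ?_, isLocallyFiniteMeasure_blowup hs.ne', c, fun i => s * r i, hc,
    fun i => mul_pos hs (hr i), by simpa using hr0.const_mul s, ?_⟩
  · have h1 : blowup (blowup ν 0 s) 0 s⁻¹ = 0 := by rw [h, blowup_zero]
    rwa [blowup_blowup, inv_mul_cancel₀ hs.ne', blowup_one] at h1
  · simpa only [blowup_smul, blowup_blowup] using hlim.blowup hs.ne'

variable [NeZero n]

lemma dCone_blowup [IsLocallyFiniteMeasure ν] (hF : IsDCone F) (hs : 0 < s) (ht : 0 < t) :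
    dCone s (blowup ν 0 t) F = dCone (s * t) ν F := by
  have := isLocallyFiniteMeasure_blowup (μ := ν) ht.ne'
  rw [dCone_eq_dCone_blowup hF hs, blowup_blowup, ← dCone_eq_dCone_blowup hF (mul_pos hs ht)]

lemma Fb_one_blowup_pos [IsLocallyFiniteMeasure ν] (hs : 0 < s) (h : 0 < Fb s ν) :
    0 < Fb 1 (blowup ν 0 s) := by
  have hb := mul_Fb_blowup (μ := ν) (s := 1) hs
  rw [mul_one] at hb
  rw [← hb] at h
  exact (pos_iff_pos_of_mul_pos h).1 hs

lemma continuousOn_dCone [IsLocallyFiniteMeasure ν] (hF : IsDCone F)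
    (hex : ∃ m ∈ F, Fb 1 m = 1) (hν : ∀ t, 0 < t → 0 < Fb t ν) :
    ContinuousOn (fun t => dCone t ν F) (Ioi 0) := by
  rw [continuousOn_iff_continuous_domRestrict, continuous_iff_continuousAt]
  intro r
  have := isLocallyFiniteMeasure_blowup_coe (μ := ν)
  have h := (vagueTendsto_blowup (μ := ν) r).tendsto_dCone hF hex
    (Fb_one_blowup_pos r.2 (hν r r.2))
  rw [← dCone_eq_dCone_blowup hF r.2] at h
  exact h.congr fun t => (dCone_eq_dCone_blowup hF t.2).symm

lemma Fb_two_pow_le [IsLocallyFiniteMeasure ν] (hF : IsDCone F) {C : ℝ} (hC : 0 < C)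
    (hdbl : ∀ (ν : Measure (EuclideanSpace ℝ (Fin n))) [IsLocallyFiniteMeasure ν],
      0 < Fb 1 ν → dCone 1 ν F < C⁻¹ → Fb 1 ν ≤ C * Fb 2⁻¹ ν)
    (hν : ∀ t, 0 < t → 0 < Fb t ν) {j : ℕ} (hj : ∀ i ≤ j, dCone (2 ^ i) ν F < C⁻¹) :
    Fb (2 ^ j) ν ≤ C ^ j * Fb 1 ν := by
  induction j with
  | zero => simp
  | succ j ih =>
    have h2 : (0 : ℝ) < 2 ^ (j + 1) := by positivity
    have := isLocallyFiniteMeasure_blowup (μ := ν) h2.ne'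
    have h := hdbl (blowup ν 0 (2 ^ (j + 1))) (Fb_one_blowup_pos h2 (hν _ h2))
      (by rw [← dCone_eq_dCone_blowup hF h2]; exact hj _ le_rfl)
    have h3 := mul_le_mul_of_nonneg_left h h2.le
    have e : (2 : ℝ) ^ (j + 1) * 2⁻¹ = 2 ^ j := by rw [pow_succ]; ring
    rw [mul_left_comm, mul_Fb_blowup h2, mul_Fb_blowup h2, mul_one, e] at h3
    have h4 := mul_le_mul_of_nonneg_left (ih fun i hi => hj i (hi.trans j.le_succ)) hC.le
    rw [pow_succ' C, mul_assoc]
    linarith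

lemma exists_tendsto_dCone_of_mem_tangents [IsLocallyFiniteMeasure ρ] (hF : IsDCone F)
    (hex : ∃ m ∈ F, Fb 1 m = 1) (hν : ν ∈ tangents ρ) :
    ∃ r : ℕ → ℝ, (∀ i, 0 < r i) ∧ Tendsto r atTop (𝓝 0) ∧ ∀ s, 0 < s → 0 < Fb s ν →
      Tendsto (fun i => dCone (s * r i) ρ F) atTop (𝓝 (dCone s ν F)) := by
  obtain ⟨-, hlf, c, r, hc, hr, hr0, hlim⟩ := hν
  refine ⟨r, hr, hr0, fun s hs hsν => ?_⟩
  have hlf1 := fun i => isLocallyFiniteMeasure_blowup (μ := ρ) (hr i).ne'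
  have hlf2 := fun i => isLocallyFiniteMeasure_blowup
    (μ := ENNReal.ofReal (c i) • blowup ρ 0 (r i)) hs.ne'
  have := isLocallyFiniteMeasure_blowup (μ := ν) hs.ne'
  have h := (hlim.blowup hs.ne').tendsto_dCone hF hex (Fb_one_blowup_pos hs hsν)
  rw [← dCone_eq_dCone_blowup hF hs] at h
  refine h.congr fun i => ?_
  rw [← dCone_eq_dCone_blowup hF hs, dCone_smul (hc i), dCone_blowup hF hs (hr i)]

lemma Fb_pos_of_mem_tangents [IsLocallyFiniteMeasure ρ] (hν : ν ∈ tangents ρ)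
    (hpos : ∀ t, 0 < t → 0 < Fb t ν) (ht : 0 < t) : 0 < Fb t ρ := by
  obtain ⟨-, hlf, c, r, hc, hr, hr0, hlim⟩ := hν
  have hlf1 := fun i => isLocallyFiniteMeasure_blowup (μ := ρ) (hr i).ne'
  obtain ⟨i, hi1, hi2⟩ := (((hlim.tendsto_Fb 1).eventually_const_lt (hpos 1 one_pos)).and
    (hr0.eventually_lt_const ht)).exists
  rw [Fb_smul (hc i).le] at hi1
  have h1 := mul_pos (hr i) ((pos_iff_pos_of_mul_pos hi1).1 (hc i))
  rw [mul_Fb_blowup (hr i), mul_one] at h1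
  exact h1.trans_le (Fb_mono hi2.le)

/-- If some but not all tangent measures belong to a d-cone with compact basis, there are tangent
measures at every small distance from the cone that do not move away from it at large scales. -/
lemma exists_mem_tangents_dCone_eq [IsLocallyFiniteMeasure ρ] (hF : IsDCone F)
    (hc : HasCompactBasis F) (hν : ν ∈ tangents ρ) (hνF : ν ∈ F) (hω : ω ∈ tangents ρ)
    (hωF : ω ∉ F) :
    ∃ ε₀, 0 < ε₀ ∧ ∀ ε, 0 < ε → ε < ε₀ →
      ∃ η ∈ tangents ρ, dCone 1 η F = ε ∧ ∀ r, 1 ≤ r → dCone r η F ≤ ε := by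
  have hne : F.Nonempty := ⟨ν, hνF⟩
  have hex := exists_mem_Fb_eq_one hF hc hne one_pos
  have hνpos : ∀ t, 0 < t → 0 < Fb t ν := fun t => Fb_pos_of_mem hF hc hνF
  have hρ : ∀ t, 0 < t → 0 < Fb t ρ := fun t => Fb_pos_of_mem_tangents hν hνpos
  have hωlf := hω.2.1
  obtain ⟨s₀, hs₀, hs₀ω, hδ⟩ : ∃ s, 0 < s ∧ 0 < Fb s ω ∧ 0 < dCone s ω F := by
    by_contra! h
    exact hωF (mem_of_forall_dCone_eq_zero hF hc hne hω.1 fun s hs hsω =>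
      le_antisymm (h s hs hsω) dCone_nonneg)
  obtain ⟨C, hC, hdbl⟩ := exists_Fb_one_le_mul_Fb_half hF hc hne
  refine ⟨min (dCone s₀ ω F) C⁻¹, by positivity, fun ε hε hεlt => ?_⟩
  rw [lt_min_iff] at hεlt
  have h0 : ∀ a, 0 < a → ∀ η, 0 < η → ∃ r ∈ Ioo 0 η, dCone r ρ F < a := by
    intro a ha η hη
    obtain ⟨r, hr, hr0, hlim⟩ := exists_tendsto_dCone_of_mem_tangents hF hex hν
    have h := hlim 1 one_pos (hνpos 1 one_pos)
    rw [dCone_one_eq_zero_of_mem hF hc hνF] at h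
    simp_rw [one_mul] at h
    obtain ⟨i, hi, hi'⟩ := ((h.eventually_lt_const ha).and (hr0.eventually_lt_const hη)).exists
    exact ⟨r i, ⟨hr i, hi'⟩, hi⟩
  have h1 : ∀ η, 0 < η → ∃ s ∈ Ioo 0 η, ε < dCone s ρ F := by
    intro η hη
    obtain ⟨r, hr, hr0, hlim⟩ := exists_tendsto_dCone_of_mem_tangents hF hex hω
    have h := hlim s₀ hs₀ hs₀ω
    have h2 : Tendsto (fun i => s₀ * r i) atTop (𝓝 0) := by simpa using hr0.const_mul s₀
    obtain ⟨i, hi, hi'⟩ :=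
      ((h.eventually_const_lt hεlt.1).and (h2.eventually_lt_const hη)).exists
    exact ⟨s₀ * r i, ⟨mul_pos hs₀ (hr i), hi'⟩, hi⟩
  have hcross : ∀ k : ℕ, ∃ t ∈ Ioo 0 (1 / ((k : ℝ) + 1)), dCone t ρ F = ε ∧
      ∀ t' ∈ Icc t (((k : ℝ) + 1) * t), dCone t' ρ F ≤ ε := by
    intro k
    have hk : (0 : ℝ) < k + 1 := by positivity
    obtain ⟨C', hC', hsmall⟩ := exists_dCone_le_mul_dCone_one hF hc hne hk
    refine exists_last_crossing (continuousOn_dCone hF hex hρ) hε h0 h1 hk hC' ?_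
      Nat.one_div_pos_of_nat
    intro t ht s hks hs
    have hs0 : 0 < s := (inv_pos.2 hk).trans_le hks
    have := isLocallyFiniteMeasure_blowup (μ := ρ) ht.ne'
    have hpos : 0 < Fb s (blowup ρ 0 t) := by
      have h := hρ _ (mul_pos ht hs0)
      rw [← mul_Fb_blowup ht] at h
      exact (pos_iff_pos_of_mul_pos h).1 ht
    have h := hsmall (blowup ρ 0 t) s hks hs hpos
    rwa [dCone_blowup hF hs0 ht, dCone_blowup hF one_pos ht, one_mul] at h
  choose t ht htε htle using hcross
  have hlf := fun k => isLocallyFiniteMeasure_blowup (μ := ρ) (ht k).1.ne'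
  have hpos1 : ∀ k, 0 < Fb 1 (blowup ρ 0 (t k)) := fun k =>
    Fb_one_blowup_pos (ht k).1 (hρ _ (ht k).1)
  let m : ℕ → Measure (EuclideanSpace ℝ (Fin n)) := fun k => normalize (blowup ρ 0 (t k))
  have hmlf : ∀ k, IsLocallyFiniteMeasure (m k) := fun k => inferInstanceAs
    (IsLocallyFiniteMeasure (normalize (blowup ρ 0 (t k))))
  have hm1 : ∀ k, Fb 1 (m k) = 1 := fun k => Fb_one_normalize (hpos1 k)
  have hmd : ∀ k r, 0 < r → dCone r (m k) F = dCone (r * t k) ρ F := fun k r hr =>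
    (dCone_smul (inv_pos.2 (hpos1 k))).trans (dCone_blowup hF hr (ht k).1)
  have hmle : ∀ (k : ℕ) r, 1 ≤ r → r ≤ (k : ℝ) + 1 → dCone r (m k) F ≤ ε := fun k r hr hrk => by
    rw [hmd k r (one_pos.trans_le hr)]
    exact htle k _ ⟨le_mul_of_one_le_left (ht k).1.le hr,
      mul_le_mul_of_nonneg_right hrk (ht k).1.le⟩
  have hmpos : ∀ k r, 0 < r → 0 < Fb r (m k) := fun k r hr => by
    have h := hρ _ (mul_pos (ht k).1 hr)
    rw [← mul_Fb_blowup (ht k).1] at h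
    rw [Fb_normalize]
    exact mul_pos (inv_pos.2 (hpos1 k)) ((pos_iff_pos_of_mul_pos h).1 (ht k).1)
  have hbdd : ∀ r, ∃ B, ∀ᶠ k in atTop, Fb r (m k) ≤ B := by
    intro r
    obtain ⟨j, hj⟩ := pow_unbounded_of_one_lt r (one_lt_two (α := ℝ))
    refine ⟨C ^ j, ?_⟩
    filter_upwards [eventually_ge_atTop (2 ^ j)] with k hk
    refine (Fb_mono hj.le).trans ((Fb_two_pow_le hF hC hdbl (hmpos k) fun i hi => ?_).trans_eq
      (by rw [hm1, mul_one]))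
    refine (hmle k _ (one_le_pow₀ one_le_two) ?_).trans_lt hεlt.2
    have h2 : (2 : ℝ) ^ i ≤ 2 ^ j := pow_le_pow_right₀ one_le_two hi
    have h3 : ((2 ^ j : ℕ) : ℝ) ≤ k := Nat.cast_le.2 hk
    push_cast at h3
    linarith
  obtain ⟨η, hη, φ, hφ, hlim⟩ := exists_subseq_vagueTendsto hbdd
  have hη1 : Fb 1 η = 1 :=
    tendsto_nhds_unique (hlim.tendsto_Fb 1) (by simp_rw [hm1]; exact tendsto_const_nhds)
  have hηd : ∀ r, 1 ≤ r → Tendsto (fun k => dCone r (m (φ k)) F) atTop (𝓝 (dCone r η F)) := by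
    intro r hr
    have hr0 := one_pos.trans_le hr
    have := isLocallyFiniteMeasure_blowup (μ := η) hr0.ne'
    have := fun k => isLocallyFiniteMeasure_blowup (μ := m (φ k)) hr0.ne'
    have h := (hlim.blowup hr0.ne').tendsto_dCone hF hex
      (Fb_one_blowup_pos hr0 (by linarith [Fb_mono (μ := η) hr]))
    simpa only [← dCone_eq_dCone_blowup hF hr0] using h
  refine ⟨η, ⟨?_, hη, _, fun k => t (φ k), fun k => inv_pos.2 (hpos1 (φ k)), fun k => (ht _).1,
    ?_, hlim⟩, ?_, fun r hr => ?_⟩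
  · rintro rfl
    rw [Fb, Fr_self] at hη1
    exact zero_ne_one hη1
  · exact squeeze_zero (fun k => (ht _).1.le) (fun k => (ht _).2.le)
      (tendsto_one_div_add_atTop_nhds_zero_nat.comp hφ)
  · refine tendsto_nhds_unique (hηd 1 le_rfl) ?_
    simp_rw [hmd _ 1 one_pos, one_mul, htε]
    exact tendsto_const_nhds
  · refine le_of_tendsto (hηd r hr) ?_
    filter_upwards [hφ.eventually_ge_atTop ⌈r⌉₊] with k hk
    exact hmle _ r hr (by linarith [Nat.ceil_le.1 hk])

end Tangents

/-- In dimension zero, a d-cone that is not empty contains all nonzero Radon measures. -/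
lemma mem_of_dim_eq_zero {F : Set (Measure (EuclideanSpace ℝ (Fin 0)))} (hF : IsDCone F)
    {μ ν : Measure (EuclideanSpace ℝ (Fin 0))} (hμ : μ ∈ F) (hν : ν ≠ 0)
    [IsLocallyFiniteMeasure ν] : ν ∈ F := by
  have hμlf := (hF.1 μ hμ).2
  have hfin : ∀ (m : Measure (EuclideanSpace ℝ (Fin 0))) [IsLocallyFiniteMeasure m],
      m univ ≠ ⊤ := fun m _ => (isCompact_univ.measure_lt_top (μ := m)).ne
  have hμ0 : μ univ ≠ 0 := fun h => (hF.1 μ hμ).1 (Measure.measure_univ_eq_zero.1 h)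
  have hν0 : ν univ ≠ 0 := fun h => hν (Measure.measure_univ_eq_zero.1 h)
  have hne : ν univ / μ univ ≠ ⊤ := ENNReal.div_ne_top (hfin ν) hμ0
  have hpos : 0 < (ν univ / μ univ).toReal :=
    ENNReal.toReal_pos (ENNReal.div_ne_zero.2 ⟨hν0, hfin μ⟩) hne
  have h : ENNReal.ofReal (ν univ / μ univ).toReal • μ = ν := by
    ext s -
    rcases s.eq_empty_or_nonempty with rfl | hs
    · simp
    · rw [Subsingleton.eq_univ_of_nonempty hs, ENNReal.ofReal_toReal hne, Measure.smul_apply,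
        smul_eq_mul, ENNReal.div_mul_cancel hμ0 (hfin μ)]
  exact h ▸ hF.2.1 μ hμ _ hpos

end TangentCone

open TangentCone

/-- Connectedness of the cone of Λ-tangent measures: if `𝓕 = ⋃ᵢ 𝓕ᵢ` with each `𝓕ᵢ` a d-cone
with compact basis, `M` is a d-cone with closed basis containing `𝓕`, and each property `(Pᵢ)`
holds, then for every `p` with `Tan_Λ(μ,p) ⊆ M`, either `Tan_Λ(μ,p) ⊆ 𝓕` or
`Tan_Λ(μ,p) ∩ 𝓕 = ∅`. -/
theorem connectedness_of_tangent_cone {n : ℕ}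
    (μ : Measure (EuclideanSpace ℝ (Fin n))) [IsLocallyFiniteMeasure μ]
    (Λ : EuclideanSpace ℝ (Fin n) → (EuclideanSpace ℝ (Fin n) ≃L[ℝ] EuclideanSpace ℝ (Fin n)))
    (Fi : ℕ → Set (Measure (EuclideanSpace ℝ (Fin n))))
    (hFi : ∀ i, IsDCone (Fi i) ∧ HasCompactBasis (Fi i))
    (M : Set (Measure (EuclideanSpace ℝ (Fin n))))
    (hM : IsDCone M) (hMb : HasClosedBasis M)
    (hsub : (⋃ i, Fi i) ⊆ M)
    (hP : ∀ i : ℕ, ∃ εi : ℝ, 0 < εi ∧ ∃ Ri : ℝ, 0 < Ri ∧ ∀ ε : ℝ, 0 < ε → ε < εi →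
      ¬ ∃ ν ∈ M \ (⋃ j < i, Fi j),
        (∀ r : ℝ, Ri ≤ r → dCone r ν (Fi i) ≤ ε) ∧ dCone Ri ν (Fi i) = ε)
    (p : EuclideanSpace ℝ (Fin n)) (hTan : TanL Λ μ p ⊆ M) :
    TanL Λ μ p ⊆ (⋃ i, Fi i) ∨ TanL Λ μ p ∩ (⋃ i, Fi i) = ∅ := by
  classical
  rw [tanL_eq_tangents] at hTan ⊢
  set ρ := blowupL Λ μ p 1
  have hρ : IsLocallyFiniteMeasure ρ := isLocallyFiniteMeasure_blowupL
  by_contra! hcon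
  obtain ⟨hsub', hne⟩ := hcon
  obtain ⟨ω, hω, hωF⟩ := not_subset.1 hsub'
  obtain ⟨ν₀, hν₀, hν₀F⟩ := hne
  have hex : ∃ i, ∃ ν ∈ tangents ρ, ν ∈ Fi i := by
    obtain ⟨i, hi⟩ := mem_iUnion.1 hν₀F
    exact ⟨i, ν₀, hν₀, hi⟩
  obtain ⟨ν, hν, hνF⟩ := Nat.find_spec hex
  set i := Nat.find hex
  have hωi : ω ∉ Fi i := fun h => hωF (mem_iUnion.2 ⟨i, h⟩)
  obtain ⟨hF, hc⟩ := hFi i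
  have hωlf := hω.2.1
  rcases eq_or_ne n 0 with rfl | hn
  · exact hωi (mem_of_dim_eq_zero hF hνF hω.1)
  have : NeZero n := ⟨hn⟩
  obtain ⟨ε₀, hε₀, h⟩ := exists_mem_tangents_dCone_eq hF hc hν hνF hω hωi
  obtain ⟨ε₁, hε₁, R, hR, hP⟩ := hP i
  have hmin : 0 < min ε₀ ε₁ := lt_min hε₀ hε₁
  obtain ⟨η, hη, hη1, hηle⟩ := h (min ε₀ ε₁ / 2) (by positivity)
    (by linarith [min_le_left ε₀ ε₁])
  have hηlf := hη.2.1
  have hR' := inv_pos.2 hR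
  refine hP (min ε₀ ε₁ / 2) (by positivity) (by linarith [min_le_right ε₀ ε₁])
    ⟨blowup η 0 R⁻¹, ⟨hM.2.2 _ (hTan hη) _ hR', ?_⟩, fun r hr => ?_, ?_⟩
  · intro hmem
    obtain ⟨j, hj, hjF⟩ := mem_iUnion₂.1 hmem
    exact Nat.find_min hex hj ⟨_, blowup_mem_tangents hη hR', hjF⟩
  · rw [dCone_blowup hF (hR.trans_le hr) hR']
    exact hηle _ (by rwa [← div_eq_mul_inv, one_le_div hR])
  · rw [dCone_blowup hF hR hR', mul_inv_cancel₀ hR.ne', hη1]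
end

section
/- Let ω⁺, ω⁻ be Radon measures on ℝⁿ, let p ∈ spt ω⁺ ∩ spt ω⁻, let F₁ ⊆ ℝⁿ be Borel, and let h : ℝⁿ → [0,∞) be Borel with ω⁻ restricted to F₁ equal to h·(ω⁺ restricted to F₁). Assume: (i) 0 < h(p) < ∞; (ii) there exist C₀ ≥ 1 and r₀ > 0 such that 0 < ω^±(B(p,r)) < ∞ and ω^±(B(p,2r)) ≤ C₀ ω^±(B(p,r)) for all 0 < r ≤ r₀; (iii) lim_{r→0} ω⁻(B(p,r) ∖ F₁)/ω⁻(B(p,r)) = 0; (iv) lim_{r→0} (1/ω⁺(B(p,r))) ∫_{B(p,r) ∩ F₁} |h(q) − h(p)| dω⁺(q) = 0; (v) lim_{r→0} ω⁻(B(p,r))/ω⁺(B(p,r)) = h(p). Let r_i ↓ 0 and suppose that the measures ω_i^± := ω^±(B(p,r_i))^{−1} T_{p,r_i}[ω^±] converge in the weak-* sense to Radon measures ω_∞^±. Then ω_∞^+ = ω_∞^−. -/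
open MeasureTheory Metric Filter Topology Set

/-- Iterating the doubling inequality at small scales. -/
theorem eventually_measureReal_ball_two_pow_mul_le {X : Type*} [PseudoMetricSpace X]
    [MeasurableSpace X] {μ : Measure X} {p : X} {C r₀ : ℝ} (hC : 0 ≤ C) (hr₀ : 0 < r₀)
    (hd : ∀ r : ℝ, 0 < r → r ≤ r₀ → μ.real (ball p (2 * r)) ≤ C * μ.real (ball p r)) (k : ℕ) :
    ∀ᶠ s in 𝓝[>] (0 : ℝ), μ.real (ball p (2 ^ k * s)) ≤ C ^ k * μ.real (ball p s) := by
  induction k with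
  | zero => simp
  | succ k ih =>
    have hpos : (0 : ℝ) < 2 ^ k := by positivity
    filter_upwards [ih, Ioc_mem_nhdsGT (div_pos hr₀ hpos)] with s hs hs'
    have h1 := hd (2 ^ k * s) (mul_pos hpos hs'.1)
      (by have := (le_div_iff₀ hpos).1 hs'.2; linarith)
    calc μ.real (ball p (2 ^ (k + 1) * s)) = μ.real (ball p (2 * (2 ^ k * s))) := by ring_nf
      _ ≤ C * (C ^ k * μ.real (ball p s)) := h1.trans (mul_le_mul_of_nonneg_left hs hC)
      _ = C ^ (k + 1) * μ.real (ball p s) := by ring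

section Density

variable {X : Type*} [MeasurableSpace X] {μ ν : Measure X} {F U : Set X} {h : X → ℝ}

theorem setIntegral_inter_eq_of_restrict_eq_withDensity (hU : MeasurableSet U)
    (hh : Measurable h) (hnn : ∀ x, 0 ≤ h x)
    (hdens : ν.restrict F = (μ.restrict F).withDensity fun x => ENNReal.ofReal (h x))
    (g : X → ℝ) : ∫ x in U ∩ F, g x ∂ν = ∫ x in U ∩ F, h x * g x ∂μ := by
  rw [← Measure.restrict_restrict hU, hdens, restrict_withDensity hU,
    integral_withDensity_eq_integral_toReal_smul hh.ennreal_ofReal (by simp),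
    Measure.restrict_restrict hU]
  simp [ENNReal.toReal_ofReal, hnn]

theorem integrableOn_inter_of_restrict_eq_withDensity (hU : MeasurableSet U)
    (hh : Measurable h) (hnn : ∀ x, 0 ≤ h x)
    (hdens : ν.restrict F = (μ.restrict F).withDensity fun x => ENNReal.ofReal (h x))
    (hνU : ν U ≠ ⊤) : IntegrableOn h (U ∩ F) μ := by
  have h1 : IntegrableOn (fun _ => (1 : ℝ)) (U ∩ F) ν :=
    integrableOn_const (measure_ne_top_of_subset inter_subset_left hνU)
  rw [IntegrableOn, ← Measure.restrict_restrict hU, hdens, restrict_withDensity hU,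
    integrable_withDensity_iff_integrable_smul' hh.ennreal_ofReal (by simp),
    Measure.restrict_restrict hU] at h1
  simpa [ENNReal.toReal_ofReal, hnn, IntegrableOn] using h1

theorem abs_setIntegral_inter_sub_le (hU : MeasurableSet U)
    (hh : Measurable h) (hnn : ∀ x, 0 ≤ h x)
    (hdens : ν.restrict F = (μ.restrict F).withDensity fun x => ENNReal.ofReal (h x))
    (hμU : μ U ≠ ⊤) (hνU : ν U ≠ ⊤) {g : X → ℝ} (hg : Measurable g) {M : ℝ}
    (hM : ∀ x, |g x| ≤ M) (c : ℝ) :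
    |∫ x in U ∩ F, g x ∂ν - c * ∫ x in U ∩ F, g x ∂μ| ≤
      M * ∫ x in U ∩ F, |h x - c| ∂μ := by
  have : IsFiniteMeasure (μ.restrict (U ∩ F)) :=
    ⟨by simpa using (measure_ne_top_of_subset inter_subset_left hμU).lt_top⟩
  have hhi : Integrable h (μ.restrict (U ∩ F)) :=
    integrableOn_inter_of_restrict_eq_withDensity hU hh hnn hdens hνU
  have hgi : Integrable g (μ.restrict (U ∩ F)) :=
    Integrable.of_bound hg.aestronglyMeasurable M (Eventually.of_forall hM)
  have hhg : Integrable (fun x => h x * g x) (μ.restrict (U ∩ F)) :=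
    hhi.mul_bdd hg.aestronglyMeasurable (Eventually.of_forall hM)
  rw [setIntegral_inter_eq_of_restrict_eq_withDensity hU hh hnn hdens, ← integral_const_mul,
    ← integral_sub hhg (hgi.const_mul c), ← integral_const_mul]
  rw [← Real.norm_eq_abs]
  refine norm_integral_le_of_norm_le ((hhi.sub (integrable_const c)).abs.const_mul M)
    (Eventually.of_forall fun x => ?_)
  rw [← sub_mul, Real.norm_eq_abs, abs_mul, mul_comm]
  exact mul_le_mul_of_nonneg_right (hM x) (abs_nonneg _)

theorem abs_integral_sub_le_s15 (hF : MeasurableSet F) (hU : MeasurableSet U)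
    (hh : Measurable h) (hnn : ∀ x, 0 ≤ h x)
    (hdens : ν.restrict F = (μ.restrict F).withDensity fun x => ENNReal.ofReal (h x))
    (hμU : μ U ≠ ⊤) (hνU : ν U ≠ ⊤) {g : X → ℝ} (hg : Measurable g) {M : ℝ}
    (hM : ∀ x, |g x| ≤ M) (hgU : ∀ x, x ∉ U → g x = 0) {c : ℝ} (hc : 0 ≤ c) :
    |∫ x, g x ∂ν - c * ∫ x, g x ∂μ| ≤
      M * (ν.real (U \ F) + ∫ x in U ∩ F, |h x - c| ∂μ + c * μ.real (U \ F)) := by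
  have split (κ : Measure X) (hκ : κ U ≠ ⊤) :
      ∫ x, g x ∂κ = ∫ x in U ∩ F, g x ∂κ + ∫ x in U \ F, g x ∂κ := by
    have hi : IntegrableOn g U κ := Measure.integrableOn_of_bounded hκ hg.aestronglyMeasurable
      (Eventually.of_forall hM)
    rw [integral_inter_add_sdiff hF hi, setIntegral_eq_integral_of_forall_compl_eq_zero hgU]
  have bound (κ : Measure X) (hκ : κ U ≠ ⊤) : |∫ x in U \ F, g x ∂κ| ≤ M * κ.real (U \ F) := by
    rw [← Real.norm_eq_abs]
    exact norm_setIntegral_le_of_norm_le_const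
      (measure_ne_top_of_subset sdiff_subset hκ).lt_top fun x _ => hM x
  rw [split ν hνU, split μ hμU]
  have h1 := abs_setIntegral_inter_sub_le hU hh hnn hdens hμU hνU hg hM c
  have h2 := bound ν hνU
  have h3 := mul_le_mul_of_nonneg_left (bound μ hμU) hc
  rw [abs_le] at h1 h2 ⊢
  rw [← abs_of_nonneg hc, ← abs_mul, abs_of_nonneg hc, abs_le] at h3
  constructor <;> linarith [h1.1, h1.2, h2.1, h2.2, h3.1, h3.2]

end Density

section Blowup

variable {E : Type*} [NormedAddCommGroup E] [NormedSpace ℝ E] [MeasurableSpace E] [BorelSpace E]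

theorem integral_smul_map_rescale (μ : Measure E) (p : E) (s : ℝ) (a : ENNReal) {f : E → ℝ}
    (hf : Continuous f) [SecondCountableTopology E] :
    ∫ x, f x ∂(a⁻¹ • Measure.map (fun x => s⁻¹ • (x - p)) μ) =
      (∫ x, f (s⁻¹ • (x - p)) ∂μ) / a.toReal := by
  rw [integral_smul_measure, integral_map (by fun_prop) hf.aestronglyMeasurable]
  simp [div_eq_inv_mul]

/-- A weak-* limit of blow-ups normalized on the unit ball is automatically locally finite: the
limits of the integrals of bump functions are nonzero, so bump functions are integrable. -/
theorem isFiniteMeasureOnCompacts_of_tendsto_rescale [ProperSpace E]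
    (μ : Measure E) [IsLocallyFiniteMeasure μ] (p : E)
    (hpos : ∀ r : ℝ, 0 < r → 0 < μ (ball p r)) {r : ℕ → ℝ} (hr : ∀ i, 0 < r i) {ν : Measure E}
    (hconv : ∀ f : E → ℝ, Continuous f → HasCompactSupport f →
      Tendsto (fun i => ∫ x, f x
        ∂((μ (ball p (r i)))⁻¹ • Measure.map (fun x => (r i)⁻¹ • (x - p)) μ))
        atTop (𝓝 (∫ x, f x ∂ν))) :
    IsFiniteMeasureOnCompacts ν := by
  refine ⟨fun K hK => ?_⟩
  obtain ⟨f, hf1, -, hfc, hf01⟩ := exists_continuous_one_zero_of_isCompact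
    (hK.union (isCompact_closedBall (0 : E) 1)) isClosed_empty (disjoint_empty _)
  have hlim : 1 ≤ ∫ x, f x ∂ν := by
    refine ge_of_tendsto' (hconv f f.continuous hfc) fun i => ?_
    have hfin : μ (ball p (r i)) < ⊤ := measure_ball_lt_top
    have hA : 0 < μ.real (ball p (r i)) := ENNReal.toReal_pos (hpos _ (hr i)).ne' hfin.ne
    rw [integral_smul_map_rescale _ _ _ _ f.continuous]
    change 1 ≤ _ / μ.real (ball p (r i))
    rw [one_le_div hA, ← integral_indicator_one measurableSet_ball]
    have hcs : HasCompactSupport fun x => f ((r i)⁻¹ • (x - p)) :=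
      hfc.comp_homeomorph ((Homeomorph.subRight p).trans
        (Homeomorph.smulOfNeZero (r i)⁻¹ (inv_ne_zero (hr i).ne')))
    refine integral_mono ((integrable_indicator_iff measurableSet_ball).2
      (integrableOn_const hfin.ne)) (Continuous.integrable_of_hasCompactSupport
        (f.continuous.comp (by fun_prop)) hcs) fun x => ?_
    refine indicator_apply_le' (fun hx => ?_) (fun _ => (hf01 _).1)
    have : (r i)⁻¹ • (x - p) ∈ closedBall (0 : E) 1 := by
      rw [mem_closedBall_zero_iff, norm_smul, norm_inv, Real.norm_of_nonneg (hr i).le,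
        inv_mul_le_iff₀ (hr i), mul_one, ← dist_eq_norm]
      exact (mem_ball.1 hx).le
    exact (hf1 (Or.inr this)).ge
  have hint : Integrable f ν := by
    by_contra hcon
    rw [integral_undef hcon] at hlim
    norm_num at hlim
  refine (measure_mono fun x hx => ?_).trans_lt
    (hint.measure_norm_ge_lt_top (ε := 1) one_pos)
  have : f x = 1 := hf1 (Or.inl hx)
  simp [this]

end Blowup

/-- Equality of the interior and exterior blow-up limits at a point of mutual absolute
continuity: if `ω⁻ = h·ω⁺` on `F₁`, `h` is approximately continuous at `p` with
`0 < h(p) < ∞`, both measures are doubling at `p`, `F₁` has full `ω⁻`-density at `p`, and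
`ω⁻(B(p,r))/ω⁺(B(p,r)) → h(p)`, then any simultaneous weak-* limits of the normalized
blow-ups of `ω⁺` and `ω⁻` along `r_i ↓ 0` coincide. -/
theorem blowup_measures_coincide {n : ℕ}
    (ωp ωm : Measure (EuclideanSpace ℝ (Fin n)))
    [IsLocallyFiniteMeasure ωp] [IsLocallyFiniteMeasure ωm]
    (p : EuclideanSpace ℝ (Fin n))
    (hspt : ∀ r : ℝ, 0 < r → 0 < ωp (ball p r) ∧ 0 < ωm (ball p r))
    (F₁ : Set (EuclideanSpace ℝ (Fin n))) (hF₁ : MeasurableSet F₁)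
    (h : EuclideanSpace ℝ (Fin n) → ℝ) (hmeas : Measurable h) (hnn : ∀ x, 0 ≤ h x)
    (hdens : ωm.restrict F₁ = (ωp.restrict F₁).withDensity (fun x => ENNReal.ofReal (h x)))
    (hhp : 0 < h p)
    (hdoub : ∃ C₀ : ℝ, 1 ≤ C₀ ∧ ∃ r₀ : ℝ, 0 < r₀ ∧ ∀ r : ℝ, 0 < r → r ≤ r₀ →
      (0 < ωp (ball p r) ∧ ωp (ball p r) < ⊤ ∧
        ωp (ball p (2 * r)) ≤ ENNReal.ofReal C₀ * ωp (ball p r)) ∧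
      (0 < ωm (ball p r) ∧ ωm (ball p r) < ⊤ ∧
        ωm (ball p (2 * r)) ≤ ENNReal.ofReal C₀ * ωm (ball p r)))
    (hdensity : Tendsto (fun r : ℝ => ωm (ball p r \ F₁) / ωm (ball p r)) (𝓝[>] (0:ℝ)) (𝓝 0))
    (happcont : Tendsto
      (fun r : ℝ => (∫ q in ball p r ∩ F₁, |h q - h p| ∂ωp) / (ωp (ball p r)).toReal)
      (𝓝[>] (0:ℝ)) (𝓝 0))
    (hratio : Tendsto (fun r : ℝ => (ωm (ball p r)).toReal / (ωp (ball p r)).toReal)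
      (𝓝[>] (0:ℝ)) (𝓝 (h p)))
    (r : ℕ → ℝ) (hr : ∀ i, 0 < r i) (hr0 : Tendsto r atTop (𝓝 0))
    (ωip ωim : Measure (EuclideanSpace ℝ (Fin n)))
    (hconvp : WeakStarTendsto
      (fun i => (ωp (ball p (r i)))⁻¹ • Measure.map (fun x => (r i)⁻¹ • (x - p)) ωp) ωip)
    (hconvm : WeakStarTendsto
      (fun i => (ωm (ball p (r i)))⁻¹ • Measure.map (fun x => (r i)⁻¹ • (x - p)) ωm) ωim) :
    ωip = ωim := by
  have hexp : Tendsto (fun s : ℝ => ωm.real (ball p s \ F₁) / ωm.real (ball p s))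
      (𝓝[>] 0) (𝓝 0) := by
    simpa [Function.comp_def, measureReal_def, ENNReal.toReal_div] using
      (ENNReal.tendsto_toReal ENNReal.zero_ne_top).comp hdensity
  change Tendsto (fun s : ℝ => ωm.real (ball p s) / ωp.real (ball p s)) _ _ at hratio
  change Tendsto (fun s : ℝ => (∫ q in ball p s ∩ F₁, |h q - h p| ∂ωp) / ωp.real (ball p s))
    _ _ at happcont
  have hfinp (s : ℝ) : ωp (ball p s) ≠ ⊤ := measure_ball_lt_top.ne
  have hfinm (s : ℝ) : ωm (ball p s) ≠ ⊤ := measure_ball_lt_top.ne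
  have hA (s : ℝ) (hs : 0 < s) : 0 < ωp.real (ball p s) :=
    ENNReal.toReal_pos (hspt s hs).1.ne' (hfinp s)
  have hB (s : ℝ) (hs : 0 < s) : 0 < ωm.real (ball p s) :=
    ENNReal.toReal_pos (hspt s hs).2.ne' (hfinm s)
  have hm : Tendsto (fun s : ℝ => ωm.real (ball p s \ F₁) / ωp.real (ball p s))
      (𝓝[>] 0) (𝓝 0) := by
    have := hexp.mul hratio
    rw [zero_mul] at this
    refine this.congr' ?_
    filter_upwards [self_mem_nhdsWithin] with s hs
    have := hB s hs
    field_simp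
  have hp : Tendsto (fun s : ℝ => h p * ωp.real (ball p s \ F₁) / ωp.real (ball p s))
      (𝓝[>] 0) (𝓝 0) := by
    have hup := ((hratio.sub_const (h p)).abs.add hm).add happcont
    simp only [sub_self, abs_zero, add_zero] at hup
    refine squeeze_zero' ?_ ?_ hup
    · exact Eventually.of_forall fun s => by positivity
    filter_upwards [self_mem_nhdsWithin] with s hs
    have hAs := hA s hs
    have h1 := abs_setIntegral_inter_sub_le measurableSet_ball hmeas hnn hdens (hfinp s)
      (hfinm s) (measurable_const (a := (1 : ℝ))) (M := 1) (by simp) (h p)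
    simp only [setIntegral_const, smul_eq_mul, mul_one, one_mul] at h1
    have h2 := measureReal_inter_add_sdiff (μ := ωp) (s := ball p s) hF₁ (hfinp s)
    have h3 := measureReal_inter_add_sdiff (μ := ωm) (s := ball p s) hF₁ (hfinm s)
    have h4 : |ωm.real (ball p s) / ωp.real (ball p s) - h p| =
        |ωm.real (ball p s) - h p * ωp.real (ball p s)| / ωp.real (ball p s) := by
      rw [div_sub' hAs.ne', abs_div, abs_of_pos hAs, mul_comm]
    rw [h4, ← add_div, ← add_div]
    refine div_le_div_of_nonneg_right ?_ hAs.le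
    have h5 := neg_abs_le (ωm.real (ball p s) - h p * ωp.real (ball p s))
    have h6 := (abs_le.1 h1).2
    have h8 : h p * ωp.real (ball p s) = h p * ωp.real (ball p s ∩ F₁) +
      h p * ωp.real (ball p s \ F₁) := by rw [← h2]; ring
    linarith
  have herr := (hm.add happcont).add hp
  simp only [add_zero, ← add_div] at herr
  obtain ⟨C, hC, r₀, hr₀, hd⟩ := hdoub
  have hdp (s : ℝ) (hs : 0 < s) (hs' : s ≤ r₀) :
      ωp.real (ball p (2 * s)) ≤ C * ωp.real (ball p s) := by
    have := ENNReal.toReal_mono (ENNReal.mul_ne_top ENNReal.ofReal_ne_top (hfinp s))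
      (hd s hs hs').1.2.2
    rwa [ENNReal.toReal_mul, ENNReal.toReal_ofReal (by linarith)] at this
  have hr0' : Tendsto r atTop (𝓝[>] 0) :=
    tendsto_nhdsWithin_iff.2 ⟨hr0, Eventually.of_forall hr⟩
  have : IsFiniteMeasureOnCompacts ωip :=
    isFiniteMeasureOnCompacts_of_tendsto_rescale ωp p (fun s hs => (hspt s hs).1) hr hconvp
  have : IsFiniteMeasureOnCompacts ωim :=
    isFiniteMeasureOnCompacts_of_tendsto_rescale ωm p (fun s hs => (hspt s hs).2) hr hconvm
  refine Measure.ext_of_integral_eq_on_compactlySupported fun f => ?_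
  have hf : Continuous f := f.continuous
  have hfc := f.hasCompactSupport
  obtain ⟨M, hM⟩ := hfc.exists_bound_of_continuous hf
  obtain ⟨R, hR⟩ := hfc.isCompact.isBounded.subset_ball 0
  obtain ⟨k, hk⟩ := pow_unbounded_of_one_lt R (one_lt_two (α := ℝ))
  have hpm := hconvp f hf hfc
  have hmm := hconvm f hf hfc
  have hpow : (0 : ℝ) < 2 ^ k := by positivity
  have hscale : Tendsto (fun s : ℝ => 2 ^ k * s) (𝓝[>] 0) (𝓝[>] 0) := by
    refine tendsto_nhdsWithin_iff.2 ⟨?_, ?_⟩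
    · have : Tendsto (fun s : ℝ => 2 ^ k * s) (𝓝 0) (𝓝 (2 ^ k * 0)) :=
        tendsto_id.const_mul _
      rw [mul_zero] at this
      exact this.mono_left nhdsWithin_le_nhds
    · filter_upwards [self_mem_nhdsWithin] with s hs
      exact mul_pos hpow hs
  have hbound := ((herr.comp hscale).const_mul (M * C ^ k)).comp hr0'
  rw [mul_zero] at hbound
  have hdiff : Tendsto (fun i => ((∫ x, f ((r i)⁻¹ • (x - p)) ∂ωm) -
      h p * ∫ x, f ((r i)⁻¹ • (x - p)) ∂ωp) / ωp.real (ball p (r i))) atTop (𝓝 0) := by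
    refine squeeze_zero_norm' ?_ hbound
    filter_upwards [hr0'.eventually (eventually_measureReal_ball_two_pow_mul_le
      (by linarith) hr₀ hdp k)] with i hi
    have hAi := hA (r i) (hr i)
    have hAk := hA (2 ^ k * r i) (mul_pos hpow (hr i))
    have key := abs_integral_sub_le_s15 hF₁ (measurableSet_ball (x := p) (ε := 2 ^ k * r i)) hmeas
      hnn hdens (hfinp _) (hfinm _) (g := fun x => f ((r i)⁻¹ • (x - p)))
      (hf.comp (by fun_prop)).measurable (fun x => hM _) (fun x hx => by
        by_contra hne
        have h1 := hR (subset_tsupport _ hne)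
        rw [mem_ball_zero_iff, norm_smul, norm_inv, Real.norm_of_nonneg (hr i).le,
          inv_mul_lt_iff₀ (hr i), ← dist_eq_norm] at h1
        refine hx (mem_ball.2 (h1.trans ?_))
        rw [mul_comm]
        exact mul_lt_mul_of_pos_right hk (hr i)) (hnn p)
    rw [norm_div, Real.norm_eq_abs, Real.norm_of_nonneg hAi.le, div_le_iff₀ hAi]
    refine key.trans ?_
    have hM0 : 0 ≤ M := (norm_nonneg _).trans (hM 0)
    set e := ωm.real (ball p (2 ^ k * r i) \ F₁) +
      ∫ x in ball p (2 ^ k * r i) ∩ F₁, |h x - h p| ∂ωp +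
      h p * ωp.real (ball p (2 ^ k * r i) \ F₁) with he
    have he0 : 0 ≤ e := by positivity
    calc M * e = M * (e / ωp.real (ball p (2 ^ k * r i))) * ωp.real (ball p (2 ^ k * r i)) := by
          field_simp
      _ ≤ M * (e / ωp.real (ball p (2 ^ k * r i))) * (C ^ k * ωp.real (ball p (r i))) := by
          gcongr
      _ = _ := by simp only [Function.comp_apply, ← he]; ring
  have hri := hratio.comp hr0'
  have hlim := (hri.mul hmm).sub (hpm.const_mul (h p))
  have huniq : h p * ∫ x, f x ∂ωim - h p * ∫ x, f x ∂ωip = 0 := by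
    refine tendsto_nhds_unique (hlim.congr fun i => ?_) hdiff
    have hAi := hA (r i) (hr i)
    have hBi := hB (r i) (hr i)
    rw [integral_smul_map_rescale ωm p (r i) _ hf, integral_smul_map_rescale ωp p (r i) _ hf]
    change ωm.real (ball p (r i)) / ωp.real (ball p (r i)) * (_ / ωm.real (ball p (r i))) -
      h p * (_ / ωp.real (ball p (r i))) = _
    field_simp
  exact (mul_left_cancel₀ hhp.ne' (sub_eq_zero.1 huniq)).symm
end
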